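/- If A and D are computably enumerable sets and neither is K-trivial, then their initial segment complexities rise simultaneously: for every constant c there exists n such that K(A↾n) > K(n) + c and K(D↾n) > K(n) + c. -/

import Mathlib

open Part Filter

open scoped Classical

namespace KPaper

/-- Binary strings. -/
abbrev Str := List Bool

/-! ### Oracle (Turing) reducibility -/

/-- The functions `ℕ →. ℕ` that are partial recursive relative to an oracle `O : ℕ →. ℕ`.
This mirrors Mathlib's `Nat.Partrec`, with an extra base case for the oracle. -/
inductive RecursiveIn (O : ℕ →. ℕ) : (ℕ →. ℕ) → Prop
  | oracle : RecursiveIn O O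
  | zero : RecursiveIn O (pure 0)
  | succ : RecursiveIn O ↑Nat.succ
  | left : RecursiveIn O ↑fun n : ℕ => n.unpair.1
  | right : RecursiveIn O ↑fun n : ℕ => n.unpair.2
  | pair {f g} : RecursiveIn O f → RecursiveIn O g →
      RecursiveIn O fun n => Nat.pair <$> f n <*> g n
  | comp {f g} : RecursiveIn O f → RecursiveIn O g → RecursiveIn O fun n => g n >>= f
  | prec {f g} : RecursiveIn O f → RecursiveIn O g → RecursiveIn O (Nat.unpaired fun a n =>
      n.rec (f a) fun y IH => do let i ← IH; g (Nat.pair a (Nat.pair y i)))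
  | rfind {f} : RecursiveIn O f →
      RecursiveIn O fun a => Nat.rfind fun n => (fun m => m = 0) <$> f (Nat.pair a n)

/-- The characteristic (partial) function of a set of naturals, used as a Turing oracle. -/
noncomputable def chi (A : Set ℕ) : ℕ →. ℕ := fun n => Part.some (if n ∈ A then 1 else 0)

/-- The characteristic function of an infinite binary sequence, used as a Turing oracle. -/
def chiSeq (X : ℕ → Bool) : ℕ →. ℕ := fun n => Part.some (cond (X n) 1 0)

/-- `A` is Turing reducible to `B`. -/
noncomputable def TuringLeSet (A B : Set ℕ) : Prop := RecursiveIn (chi B) (chi A)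

/-- `A` is Turing equivalent to `B`. -/
noncomputable def TuringEquivSet (A B : Set ℕ) : Prop := TuringLeSet A B ∧ TuringLeSet B A

/-- Turing equivalence between a set and an infinite binary sequence. -/
noncomputable def TuringEquivSetSeq (A : Set ℕ) (X : ℕ → Bool) : Prop :=
  RecursiveIn (chiSeq X) (chi A) ∧ RecursiveIn (chi A) (chiSeq X)

/-- The halting problem `∅'`. -/
def haltingSet : Set ℕ := {n | ((Denumerable.ofNat Nat.Partrec.Code n).eval n).Dom}

/-- A set of naturals is computably enumerable iff it is the domain of a
partial computable function. -/
def CESet (A : Set ℕ) : Prop := ∃ f : ℕ →. ℕ, Nat.Partrec f ∧ ∀ n, n ∈ A ↔ (f n).Dom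

/-! ### Machines and Kolmogorov complexity -/

/-- A (plain) machine is a partial computable map from binary strings to binary strings. -/
def PlainMachine (M : Str →. Str) : Prop := Partrec M

/-- A prefix-free machine: a partial computable map on binary strings whose
domain is an antichain under the prefix relation. -/
def PFMachine (M : Str →. Str) : Prop :=
  Partrec M ∧ ∀ ρ₁ ρ₂ : Str, (M ρ₁).Dom → (M ρ₂).Dom → ρ₁ <+: ρ₂ → ρ₁ = ρ₂

/-- The Kolmogorov complexity of a string `σ` with respect to a machine `M`:
the least length of an `M`-description of `σ` (`⊤` if there is none). -/
noncomputable def KC (M : Str →. Str) (σ : Str) : ℕ∞ :=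
  ⨅ ρ : {ρ : Str // σ ∈ M ρ}, ((ρ : Str).length : ℕ∞)

/-- An optimal prefix-free machine: a prefix-free machine whose associated complexity
is minimal, up to an additive constant, among all prefix-free machines. -/
def OptimalPF (U : Str →. Str) : Prop :=
  PFMachine U ∧ ∀ M : Str →. Str, PFMachine M → ∃ c : ℕ, ∀ σ : Str, KC U σ ≤ KC M σ + c

/-- An optimal plain machine. -/
def OptimalPlain (V : Str →. Str) : Prop :=
  PlainMachine V ∧ ∀ M : Str →. Str, PlainMachine M → ∃ c : ℕ, ∀ σ : Str, KC V σ ≤ KC M σ + c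

/-! ### Initial segments -/

/-- The first `n` bits of the characteristic sequence of a set of naturals. -/
noncomputable def restrSet (A : Set ℕ) (n : ℕ) : Str :=
  (List.range n).map fun i => decide (i ∈ A)

/-- The first `n` bits of an infinite binary sequence. -/
def restrSeq (X : ℕ → Bool) (n : ℕ) : Str := (List.range n).map X

/-- The string `0^n`; `K(n)` is identified with `K(0^n)`. -/
def zeroStr (n : ℕ) : Str := List.replicate n false

/-! ### `≤_K`, `<_K`, `K`-triviality (and the `≤_C` analogues) -/

def KLeSet (U : Str →. Str) (A B : Set ℕ) : Prop :=
  ∃ c : ℕ, ∀ n, KC U (restrSet A n) ≤ KC U (restrSet B n) + c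

def KLtSet (U : Str →. Str) (A B : Set ℕ) : Prop := KLeSet U A B ∧ ¬ KLeSet U B A

def KTrivialSet (U : Str →. Str) (A : Set ℕ) : Prop :=
  ∃ c : ℕ, ∀ n, KC U (restrSet A n) ≤ KC U (zeroStr n) + c

def KLeSeq (U : Str →. Str) (X Y : ℕ → Bool) : Prop :=
  ∃ c : ℕ, ∀ n, KC U (restrSeq X n) ≤ KC U (restrSeq Y n) + c

def KLtSeq (U : Str →. Str) (X Y : ℕ → Bool) : Prop := KLeSeq U X Y ∧ ¬ KLeSeq U Y X

def KTrivialSeq (U : Str →. Str) (X : ℕ → Bool) : Prop :=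
  ∃ c : ℕ, ∀ n, KC U (restrSeq X n) ≤ KC U (zeroStr n) + c

/-! ### Computably enumerable reals -/

/-- The real number in `[0,1]` whose binary expansion is the sequence `X`. -/
noncomputable def realOfSeq (X : ℕ → Bool) : ℝ := ∑' i : ℕ, cond (X i) ((2 : ℝ) ^ (i + 1))⁻¹ 0

/-- `X` (identified with the real it is the binary expansion of) is a computably
enumerable real: it is the limit of a nondecreasing computable sequence of
(dyadic) rationals. -/
def CEReal (X : ℕ → Bool) : Prop :=
  ∃ f : ℕ → ℤ, Computable f ∧
    (∀ s, (f s : ℝ) / 2 ^ s ≤ (f (s + 1) : ℝ) / 2 ^ (s + 1)) ∧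
    Tendsto (fun s => (f s : ℝ) / 2 ^ s) atTop (nhds (realOfSeq X))

/-- The characteristic sequence of a set of naturals. -/
noncomputable def seqOfSet (A : Set ℕ) : ℕ → Bool := fun i => decide (i ∈ A)

/-! ### Solovay reducibility -/

/-- Solovay reducibility on c.e. reals: `X ≤_S Y` iff there are nondecreasing computable
rational approximations to `X` and `Y` and a constant `c` such that at each stage the
distance to `X` is bounded by `c` times the distance to `Y`. -/
def SolovayLe (X Y : ℕ → Bool) : Prop :=
  ∃ (c : ℕ) (f g : ℕ → ℤ), Computable f ∧ Computable g ∧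
    (∀ s, (f s : ℝ) / 2 ^ s ≤ (f (s + 1) : ℝ) / 2 ^ (s + 1)) ∧
    (∀ s, (g s : ℝ) / 2 ^ s ≤ (g (s + 1) : ℝ) / 2 ^ (s + 1)) ∧
    Tendsto (fun s => (f s : ℝ) / 2 ^ s) atTop (nhds (realOfSeq X)) ∧
    Tendsto (fun s => (g s : ℝ) / 2 ^ s) atTop (nhds (realOfSeq Y)) ∧
    ∀ s, realOfSeq X - (f s : ℝ) / 2 ^ s ≤ (c : ℝ) * (realOfSeq Y - (g s : ℝ) / 2 ^ s)



theorem KC_le_iff (M : Str →. Str) (σ : Str) (k : ℕ) :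
    KC M σ ≤ k ↔ ∃ ρ : Str, σ ∈ M ρ ∧ ρ.length ≤ k := by
  constructor
  · intro h
    have h2 : KC M σ < ((k + 1 : ℕ) : ℕ∞) := lt_of_le_of_lt h (by exact_mod_cast Nat.lt_succ_self k)
    unfold KC at h2
    rw [iInf_lt_iff] at h2
    obtain ⟨⟨ρ, hρ⟩, h3⟩ := h2
    refine ⟨ρ, hρ, ?_⟩
    have : ρ.length < k + 1 := by exact_mod_cast h3
    omega
  · rintro ⟨ρ, hρ, hl⟩
    unfold KC
    refine le_trans (iInf_le _ (⟨ρ, hρ⟩ : {ρ : Str // σ ∈ M ρ})) ?_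
    exact_mod_cast hl

/-- Binary value of a string. -/
def sval (ρ : Str) : ℕ := ρ.foldl (fun a b => 2 * a + b.toNat) 0

theorem sval_snoc (ρ : Str) (b : Bool) : sval (ρ ++ [b]) = 2 * sval ρ + b.toNat := by
  simp [sval]

theorem sval_append (ρ u : Str) : sval (ρ ++ u) = sval ρ * 2 ^ u.length + sval u := by
  induction u using List.reverseRecOn with
  | nil => simp [sval]
  | append_singleton u b ih =>
    rw [← List.append_assoc, sval_snoc, ih, sval_snoc]
    simp [pow_succ]; ring

theorem sval_lt (ρ : Str) : sval ρ < 2 ^ ρ.length := by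
  induction ρ using List.reverseRecOn with
  | nil => simp [sval]
  | append_singleton u b ih =>
    rw [sval_snoc]
    have : b.toNat ≤ 1 := by cases b <;> simp
    simp [pow_succ]; omega

theorem exists_sval (k : ℕ) : ∀ z < 2 ^ k, ∃ ρ : Str, ρ.length = k ∧ sval ρ = z := by
  induction k with
  | zero => intro z hz; exact ⟨[], rfl, by simp at hz; simp [sval, hz]⟩
  | succ k ih =>
    intro z hz
    obtain ⟨ρ, h1, h2⟩ := ih (z / 2) (by rw [pow_succ] at hz; omega)
    refine ⟨ρ ++ [decide (z % 2 = 1)], by simp [h1], ?_⟩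
    rw [sval_snoc, h2]
    rcases Nat.mod_two_eq_zero_or_one z with h | h <;> simp [h] <;> omega

/-- left end of dyadic interval -/
theorem sval_mono_pfx {ρ ρ' : Str} (h : ρ <+: ρ') :
    (sval ρ : ℝ) * (1/2) ^ ρ.length ≤ sval ρ' * (1/2) ^ ρ'.length ∧
    ((sval ρ' : ℝ) + 1) * (1/2) ^ ρ'.length ≤ (sval ρ + 1) * (1/2) ^ ρ.length := by
  obtain ⟨u, rfl⟩ := h
  have hlt := sval_lt u
  have hlt' : (sval u : ℝ) + 1 ≤ 2 ^ u.length := by exact_mod_cast hlt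
  have e : (1/2 : ℝ) ^ ρ.length = 2 ^ u.length * (1/2) ^ (ρ ++ u).length := by
    rw [List.length_append, pow_add, mul_comm, mul_assoc, ← mul_pow]; norm_num
  rw [sval_append, e]
  have hp : (0 : ℝ) < (1/2) ^ (ρ ++ u).length := by positivity
  push_cast
  constructor
  · have : (0 : ℝ) ≤ sval u := by positivity
    nlinarith
  · nlinarith

/-- Kraft inequality. -/
theorem kraft (S : Finset Str) (hS : ∀ ρ ∈ S, ∀ ρ' ∈ S, ρ <+: ρ' → ρ = ρ') :
    ∑ ρ ∈ S, (1/2 : ℝ) ^ ρ.length ≤ 1 := by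
  by_cases h0 : ([] : Str) ∈ S
  · have : S = {[]} := by
      ext ρ
      simp only [Finset.mem_singleton]
      exact ⟨fun h => (hS _ h0 _ h ⟨_, rfl⟩).symm, fun h => h ▸ h0⟩
    simp [this]
  · have hu : InformationTheory.UniquelyDecodable (S : Set Str) := by
      intro L₁
      induction L₁ with
      | nil =>
        intro L₂ _ h2 h
        cases L₂ with
        | nil => rfl
        | cons a l =>
          exfalso
          simp at h
          exact h0 (h.1 ▸ h2 a (by simp))
      | cons a l ih =>
        intro L₂ h1 h2 h
        cases L₂ with
        | nil =>
          exfalso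
          simp at h
          exact h0 (h.1 ▸ h1 a (by simp))
        | cons b l' =>
          simp only [List.flatten_cons] at h
          have hab : a = b := by
            have hp : a <+: b ++ l'.flatten := ⟨_, h⟩
            have hp' : b <+: b ++ l'.flatten := ⟨_, rfl⟩
            rcases (le_total a.length b.length).imp (List.prefix_of_prefix_length_le hp hp')
                (List.prefix_of_prefix_length_le hp' hp) with h3 | h3
            · exact hS _ (h1 a (by simp)) _ (h2 b (by simp)) h3
            · exact (hS _ (h2 b (by simp)) _ (h1 a (by simp)) h3).symm
          subst hab
          rw [ih l' (fun w hw => h1 w (by simp [hw])) (fun w hw => h2 w (by simp [hw]))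
            (List.append_cancel_left h)]
    simpa using InformationTheory.kraft_mcmillan_inequality hu

/-! ### Kraft-Chaitin -/

noncomputable def reqList (f : ℕ → Option (ℕ × Str)) : ℕ → List (ℕ × Str)
  | 0 => []
  | t + 1 => Option.casesOn (f t) (reqList f t)
      (fun r => if r ∈ reqList f t then reqList f t else r :: reqList f t)

def wsum (R : List (ℕ × Str)) (B : ℕ) : ℕ := (R.map fun r => 2 ^ (B + 1 - r.1)).sum
def lsum (R : List (ℕ × Str)) : ℕ := (R.map fun r => r.1).sum
noncomputable def rW (R : List (ℕ × Str)) : ℝ := (R.map fun r => 2 * (1/2 : ℝ) ^ r.1).sum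

noncomputable def kcStep (f : ℕ → Option (ℕ × Str)) (ρ : Str) (t : ℕ) : Option Str :=
  (f t).bind fun r =>
    if r ∉ reqList f t ∧ ρ.length = r.1 ∧
      wsum (reqList f t) (lsum (reqList f t) + r.1) ≤ sval ρ * 2 ^ (lsum (reqList f t) + r.1 - r.1) ∧
      (sval ρ + 1) * 2 ^ (lsum (reqList f t) + r.1 - r.1) ≤
        wsum (reqList f t) (lsum (reqList f t) + r.1) + 2 ^ (lsum (reqList f t) + r.1 + 1 - r.1)
    then Option.some r.2 else Option.none

noncomputable def kcMach (f : ℕ → Option (ℕ × Str)) : Str →. Str :=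
  fun ρ => Nat.rfindOpt (kcStep f ρ)

theorem le_lsum {R : List (ℕ × Str)} {r} (h : r ∈ R) : r.1 ≤ lsum R :=
  List.le_sum_of_mem (List.mem_map_of_mem h)

theorem wsum_cast (R : List (ℕ × Str)) (B : ℕ) (h : ∀ r ∈ R, r.1 ≤ B) :
    (wsum R B : ℝ) = 2 ^ B * rW R := by
  induction R with
  | nil => simp [wsum, rW]
  | cons r R ih =>
    have h1 := ih (fun r hr => h r (by simp [hr]))
    have h2 := h r (by simp)
    simp only [wsum, rW, List.map_cons, List.sum_cons] at h1 ⊢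
    push_cast
    push_cast at h1
    rw [h1, mul_add]
    congr 1
    obtain ⟨d, rfl⟩ := Nat.exists_eq_add_of_le h2
    rw [show r.1 + d + 1 - r.1 = d + 1 by omega, pow_add, pow_add]
    have : (2 : ℝ) ^ r.1 * (1/2) ^ r.1 = 1 := by rw [← mul_pow]; norm_num
    linear_combination (-(2:ℝ) * 2 ^ d) * this

theorem kcStep_iff (f : ℕ → Option (ℕ × Str)) (ρ : Str) (t : ℕ) (σ : Str) :
    kcStep f ρ t = Option.some σ ↔ ∃ k, f t = Option.some (k, σ) ∧ (k, σ) ∉ reqList f t ∧ ρ.length = k ∧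
      rW (reqList f t) ≤ sval ρ * (1/2) ^ k ∧
      (sval ρ + 1) * (1/2) ^ k ≤ rW (reqList f t) + 2 * (1/2) ^ k := by
  have key : ∀ k : ℕ, ((wsum (reqList f t) (lsum (reqList f t) + k) ≤
        sval ρ * 2 ^ (lsum (reqList f t) + k - k)) ↔
        rW (reqList f t) ≤ sval ρ * (1/2) ^ k) ∧
      ((sval ρ + 1) * 2 ^ (lsum (reqList f t) + k - k) ≤
        wsum (reqList f t) (lsum (reqList f t) + k) + 2 ^ (lsum (reqList f t) + k + 1 - k) ↔
      (sval ρ + 1) * (1/2) ^ k ≤ rW (reqList f t) + 2 * (1/2) ^ k) := by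
    intro k
    have hc := wsum_cast (reqList f t) (lsum (reqList f t) + k)
      (fun r hr => le_trans (le_lsum hr) (by omega))
    set B := lsum (reqList f t)
    rw [show B + k - k = B by omega, show B + k + 1 - k = B + 1 by omega]
    have hk : (2 : ℝ) ^ k * (1/2) ^ k = 1 := by rw [← mul_pow]; norm_num
    have hB : (0 : ℝ) < 2 ^ (B + k) := by positivity
    have e1 : (2 : ℝ) ^ B = 2 ^ (B + k) * (1/2) ^ k := by
      rw [pow_add, mul_assoc, hk, mul_one]
    constructor
    · rw [← Nat.cast_le (α := ℝ), hc]
      push_cast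
      rw [e1, show (sval ρ : ℝ) * (2 ^ (B + k) * (1/2) ^ k) = 2 ^ (B + k) * (sval ρ * (1/2) ^ k) by ring]
      exact mul_le_mul_iff_right₀ hB
    · rw [← Nat.cast_le (α := ℝ)]
      push_cast
      rw [hc, pow_succ, e1, show ((sval ρ : ℝ) + 1) * (2 ^ (B + k) * (1/2) ^ k)
        = 2 ^ (B + k) * ((sval ρ + 1) * (1/2) ^ k) by ring,
        show 2 ^ (B + k) * rW (reqList f t) + 2 ^ (B + k) * (1/2) ^ k * 2
          = 2 ^ (B + k) * (rW (reqList f t) + 2 * (1/2) ^ k) by ring]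
      exact mul_le_mul_iff_right₀ hB
  unfold kcStep
  rw [Option.bind_eq_some_iff]
  constructor
  · rintro ⟨⟨k, τ⟩, h1, h2⟩
    split_ifs at h2 with h3
    simp only [Option.some.injEq] at h2
    subst h2
    simp only at h3
    rw [(key k).1, (key k).2] at h3
    exact ⟨k, h1, h3⟩
  · rintro ⟨k, h1, h3⟩
    refine ⟨(k, σ), h1, ?_⟩
    rw [← (key k).1, ← (key k).2] at h3
    rw [if_pos h3]

theorem reqList_mem (f : ℕ → Option (ℕ × Str)) (t : ℕ) (r) :
    r ∈ reqList f t ↔ ∃ t' < t, f t' = Option.some r := by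
  induction t with
  | zero => simp [reqList]
  | succ t ih =>
    rw [reqList]
    cases h : f t with
    | none =>
      simp only [ih]
      constructor
      · rintro ⟨t', h1, h2⟩; exact ⟨t', by omega, h2⟩
      · rintro ⟨t', h1, h2⟩
        refine ⟨t', ?_, h2⟩
        rcases Nat.lt_succ_iff_lt_or_eq.mp h1 with h3 | h3
        · exact h3
        · subst h3; rw [h] at h2; cases h2
    | some r' =>
      have : (r ∈ (if r' ∈ reqList f t then reqList f t else r' :: reqList f t)) ↔
          (r = r' ∨ r ∈ reqList f t) := by
        split_ifs with h'
        · constructor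
          · exact Or.inr
          · rintro (rfl | h2); exact h'; exact h2
        · simp
      simp only
      rw [this, ih]
      constructor
      · rintro (rfl | ⟨t', h1, h2⟩)
        · exact ⟨t, by omega, h⟩
        · exact ⟨t', by omega, h2⟩
      · rintro ⟨t', h1, h2⟩
        rcases Nat.lt_succ_iff_lt_or_eq.mp h1 with h3 | h3
        · exact Or.inr ⟨t', h3, h2⟩
        · subst h3; rw [h] at h2; left; simpa using h2.symm

theorem reqList_nodup (f : ℕ → Option (ℕ × Str)) (t : ℕ) : (reqList f t).Nodup := by
  induction t with
  | zero => simp [reqList]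
  | succ t ih =>
    rw [reqList]
    cases h : f t with
    | none => exact ih
    | some r' =>
      simp only
      split_ifs with h'
      · exact ih
      · exact List.nodup_cons.mpr ⟨h', ih⟩

theorem rW_eq (f : ℕ → Option (ℕ × Str)) (t : ℕ) :
    rW (reqList f t) = 2 * ∑ r ∈ (reqList f t).toFinset, (1/2 : ℝ) ^ r.1 := by
  rw [List.sum_toFinset _ (reqList_nodup f t), rW, List.sum_map_mul_left]

theorem rW_mono (f : ℕ → Option (ℕ × Str)) {t t' : ℕ} (h : t ≤ t') :
    rW (reqList f t) ≤ rW (reqList f t') := by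
  rw [rW_eq, rW_eq]
  gcongr
  intro r hr
  simp only [List.mem_toFinset, reqList_mem] at hr ⊢
  obtain ⟨a, b, c⟩ := hr
  exact ⟨a, by omega, c⟩

theorem rW_succ (f : ℕ → Option (ℕ × Str)) {t : ℕ} {r} (h : f t = Option.some r) (h' : r ∉ reqList f t) :
    rW (reqList f (t+1)) = rW (reqList f t) + 2 * (1/2 : ℝ) ^ r.1 := by
  rw [reqList, h]
  simp only [if_neg h', rW, List.map_cons, List.sum_cons]
  ring

theorem sval_primrec : Primrec sval :=
  Primrec.list_foldl (f := fun a : Str => a) (g := fun _ => 0)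
    (h := fun _ (p : ℕ × Bool) => 2 * p.1 + p.2.toNat) Primrec.id (Primrec.const 0)
    (Primrec.nat_add.comp (Primrec.nat_double.comp (Primrec.fst.comp Primrec.snd))
      ((Primrec.dom_bool Bool.toNat).comp (Primrec.snd.comp Primrec.snd))).to₂

theorem nat_pow_primrec : Primrec₂ (fun a b : ℕ => a ^ b) :=
  Primrec₂.unpaired'.1 Nat.Primrec.pow

theorem list_sum_primrec : Primrec (fun l : List ℕ => l.sum) :=
  (Primrec.list_foldr (f := fun a : List ℕ => a) (g := fun _ => 0)
    (h := fun _ (p : ℕ × ℕ) => p.1 + p.2) Primrec.id (Primrec.const 0)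
    (Primrec.nat_add.comp (Primrec.fst.comp Primrec.snd) (Primrec.snd.comp Primrec.snd)).to₂).of_eq
    (fun l => by simp [List.sum])

theorem list_mem_primrec {α : Type*} [Primcodable α] :
    PrimrecRel (fun (a : α) (l : List α) => a ∈ l) := by
  have h : PrimrecRel (fun (l : List α) (a : α) => ∃ b ∈ l, b = a) :=
    PrimrecRel.exists_mem_list (R := fun b a => b = a) Primrec.eq
  exact (h.swap).of_eq (fun a l => by simp [Function.swap])

theorem reqList_primrec {f : ℕ → Option (ℕ × Str)} (hf : Primrec f) : Primrec (reqList f) := by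
  have : Primrec₂ (fun (t : ℕ) (L : List (ℕ × Str)) =>
      (Option.casesOn (f t) L (fun r => if r ∈ L then L else r :: L) : List (ℕ × Str))) := by
    refine Primrec.option_casesOn (hf.comp Primrec.fst) Primrec.snd ?_
    refine Primrec.ite ?_ (Primrec.snd.comp Primrec.fst)
      (Primrec.list_cons.comp Primrec.snd (Primrec.snd.comp Primrec.fst))
    exact list_mem_primrec.comp Primrec.snd (Primrec.snd.comp Primrec.fst)
  refine (Primrec.nat_rec₁ [] this).of_eq ?_
  intro n
  induction n with
  | zero => rfl
  | succ n ih => simp only [reqList, ← ih]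

theorem wsum_primrec : Primrec₂ wsum := by
  refine list_sum_primrec.comp (Primrec.list_map Primrec.fst ?_)
  exact nat_pow_primrec.comp (Primrec.const 2)
    (Primrec.nat_sub.comp (Primrec.succ.comp (Primrec.snd.comp Primrec.fst))
      (Primrec.fst.comp Primrec.snd))

theorem lsum_primrec : Primrec lsum :=
  list_sum_primrec.comp (Primrec.list_map Primrec.id (Primrec.fst.comp Primrec.snd).to₂)

theorem kcStep_primrec {f : ℕ → Option (ℕ × Str)} (hf : Primrec f) : Primrec₂ (kcStep f) := by
  refine Primrec.option_bind (hf.comp Primrec.snd) ?_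
  have hρ : Primrec (fun q : (Str × ℕ) × (ℕ × Str) => q.1.1) := Primrec.fst.comp Primrec.fst
  have ht : Primrec (fun q : (Str × ℕ) × (ℕ × Str) => q.1.2) := Primrec.snd.comp Primrec.fst
  have hr : Primrec (fun q : (Str × ℕ) × (ℕ × Str) => q.2) := Primrec.snd
  have hk := Primrec.fst.comp hr
  have hR := (reqList_primrec hf).comp ht
  have hB := Primrec.nat_add.comp (lsum_primrec.comp hR) hk
  have hw := wsum_primrec.comp hR hB
  have hs := sval_primrec.comp hρ
  have hp := nat_pow_primrec.comp (Primrec.const 2) (Primrec.nat_sub.comp hB hk)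
  have hp2 := nat_pow_primrec.comp (Primrec.const 2)
    (Primrec.nat_sub.comp (Primrec.succ.comp hB) hk)
  refine Primrec.ite ?_ (Primrec.option_some.comp (Primrec.snd.comp hr)) (Primrec.const Option.none)
  refine PrimrecPred.and (PrimrecPred.not (list_mem_primrec.comp hr hR)) ?_
  refine PrimrecPred.and (Primrec.eq.comp (Primrec.list_length.comp hρ) hk) ?_
  refine PrimrecPred.and (Primrec.nat_le.comp hw (Primrec.nat_mul.comp hs hp)) ?_
  exact Primrec.nat_le.comp (Primrec.nat_mul.comp (Primrec.succ.comp hs) hp)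
    (Primrec.nat_add.comp hw hp2)

theorem kc_unique (f : ℕ → Option (ℕ × Str)) {ρ ρ' : Str} {t t' : ℕ} {σ σ' : Str}
    (h : kcStep f ρ t = Option.some σ) (h' : kcStep f ρ' t' = Option.some σ')
    (hp : ρ <+: ρ' ∨ ρ' <+: ρ) : t = t' := by
  by_contra hne
  wlog hlt : t < t' generalizing ρ ρ' t t' σ σ'
  · exact this h' h hp.symm (Ne.symm hne) (by omega)
  obtain ⟨k, h1, h2, h3, h4, h5⟩ := (kcStep_iff _ _ _ _).1 h
  obtain ⟨k', h1', h2', h3', h4', h5'⟩ := (kcStep_iff _ _ _ _).1 h'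
  have e1 := rW_succ f h1 h2
  have e2 := rW_mono f (Nat.succ_le_of_lt hlt)
  simp only [Nat.succ_eq_add_one] at e2
  rw [e1] at e2
  subst h3 h3'
  have hpos : (0 : ℝ) < (1/2) ^ ρ.length := by positivity
  have hpos' : (0 : ℝ) < (1/2) ^ ρ'.length := by positivity
  rcases hp with hp | hp
  · have := sval_mono_pfx hp
    nlinarith [this.1, this.2]
  · have := sval_mono_pfx hp
    nlinarith [this.1, this.2]

theorem kcMach_pf {f : ℕ → Option (ℕ × Str)} (hf : Primrec f) : PFMachine (kcMach f) := by
  constructor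
  · exact Partrec.rfindOpt (kcStep_primrec hf).to_comp
  · intro ρ₁ ρ₂ h1 h2 hp
    obtain ⟨t, σ, h⟩ := Nat.rfindOpt_dom.1 h1
    obtain ⟨t', σ', h'⟩ := Nat.rfindOpt_dom.1 h2
    have ht := kc_unique f h h' (Or.inl hp)
    subst ht
    obtain ⟨k, a1, -, a3, -⟩ := (kcStep_iff _ _ _ _).1 h
    obtain ⟨k', b1, -, b3, -⟩ := (kcStep_iff _ _ _ _).1 h'
    rw [a1] at b1
    simp only [Option.some.injEq, Prod.mk.injEq] at b1
    exact hp.eq_of_length (by omega)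

theorem kc_exists {U : Str →. Str} (hU : OptimalPF U) {f : ℕ → Option (ℕ × Str)} (hf : Primrec f)
    (hw : ∀ F : Finset (ℕ × Str), (∀ r ∈ F, ∃ t, f t = Option.some r) →
      ∑ r ∈ F, (1/2 : ℝ) ^ r.1 ≤ 1/2) :
    ∃ c : ℕ, ∀ (t k : ℕ) (σ : Str), f t = Option.some (k, σ) → KC U σ ≤ k + c := by
  obtain ⟨c, hc⟩ := hU.2 _ (kcMach_pf hf)
  refine ⟨c, fun t k σ ht => le_trans (hc σ) ?_⟩
  gcongr
  rw [KC_le_iff]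
  -- take first t
  have hex : ∃ t, f t = Option.some (k, σ) := ⟨t, ht⟩
  set t₀ := Nat.find hex with ht₀
  have h0 : f t₀ = Option.some (k, σ) := Nat.find_spec hex
  have hnot : (k, σ) ∉ reqList f t₀ := by
    rw [reqList_mem]
    rintro ⟨t', h1, h2⟩
    exact Nat.find_min hex h1 h2
  have hW1 : rW (reqList f (t₀ + 1)) ≤ 1 := by
    rw [rW_eq]
    have := hw (reqList f (t₀+1)).toFinset (fun r hr => by
      rw [List.mem_toFinset, reqList_mem] at hr
      obtain ⟨a, _, b⟩ := hr
      exact ⟨a, b⟩)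
    linarith
  rw [rW_succ f h0 hnot] at hW1
  have hW0 : 0 ≤ rW (reqList f t₀) := by rw [rW_eq]; positivity
  set W := rW (reqList f t₀)
  simp only at hW1
  have hk : (2 : ℝ) ^ k * (1/2) ^ k = 1 := by rw [← mul_pow]; norm_num
  have hp : (0 : ℝ) < (1/2) ^ k := by positivity
  have hp2 : (0 : ℝ) < 2 ^ k := by positivity
  set z := ⌈W * 2 ^ k⌉₊ with hz
  have z1 : W * 2 ^ k ≤ z := Nat.le_ceil _
  have z2 : (z : ℝ) < W * 2 ^ k + 1 := Nat.ceil_lt_add_one (by positivity)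
  have zlt : z < 2 ^ k := by
    have : (z : ℝ) < 2 ^ k := by
      have : W * 2 ^ k + 2 ≤ 2 ^ k := by nlinarith
      linarith
    exact_mod_cast this
  obtain ⟨ρ, hρ1, hρ2⟩ := exists_sval k z zlt
  have hst : kcStep f ρ t₀ = Option.some σ := by
    rw [kcStep_iff]
    refine ⟨k, h0, hnot, hρ1, ?_, ?_⟩
    · rw [hρ2]
      calc W = W * 2 ^ k * (1/2) ^ k := by rw [mul_assoc, hk, mul_one]
        _ ≤ _ := by gcongr
    · rw [hρ2]
      calc ((z : ℝ) + 1) * (1/2) ^ k ≤ (W * 2 ^ k + 2) * (1/2) ^ k :=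
        mul_le_mul_of_nonneg_right (by linarith) hp.le
        _ = _ := by rw [add_mul, mul_assoc, hk, mul_one]
  refine ⟨ρ, ?_, by omega⟩
  have hd : (kcMach f ρ).Dom := Nat.rfindOpt_dom.2 ⟨t₀, σ, hst⟩
  obtain ⟨σ', hσ'⟩ := Part.dom_iff_mem.1 hd
  obtain ⟨t', h'⟩ := Nat.rfindOpt_spec hσ'
  have := kc_unique f hst h' (Or.inl List.prefix_rfl)
  subst this
  have h'' : kcStep f ρ t₀ = Option.some σ' := h'
  rw [hst] at h''
  cases h''
  exact hσ'



theorem exists_Us {U : Str →. Str} (hU : Partrec U) : ∃ Us : ℕ → Str → Option Str, Primrec₂ Us ∧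
    (∀ s t ρ σ, s ≤ t → Us s ρ = Option.some σ → Us t ρ = Option.some σ) ∧
    ∀ ρ σ, σ ∈ U ρ ↔ ∃ s, Us s ρ = Option.some σ := by
  obtain ⟨c, hc⟩ := Nat.Partrec.Code.exists_code.1 hU
  refine ⟨fun s ρ => (Nat.Partrec.Code.evaln s c (Encodable.encode ρ)).bind Encodable.decode,
    ?_, ?_, ?_⟩
  · refine Primrec.option_bind ?_ (Primrec.decode.comp Primrec.snd).to₂
    exact Nat.Partrec.Code.primrec_evaln.comp
      (Primrec.pair (Primrec.pair Primrec.fst (Primrec.const c)) (Primrec.encode.comp Primrec.snd))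
  · intro s t ρ σ hst h
    simp only [Option.bind_eq_some_iff] at h ⊢
    obtain ⟨a, h1, h2⟩ := h
    exact ⟨a, Nat.Partrec.Code.evaln_mono hst h1, h2⟩
  · intro ρ σ
    have h1 : σ ∈ U ρ ↔ Encodable.encode σ ∈ c.eval (Encodable.encode ρ) := by
      rw [hc]; simp
    rw [h1]
    constructor
    · intro h
      obtain ⟨s, hs⟩ := Nat.Partrec.Code.evaln_complete.1 h
      refine ⟨s, ?_⟩
      rw [Option.mem_def] at hs
      simp [hs]
    · rintro ⟨s, hs⟩
      simp only [Option.bind_eq_some_iff] at hs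
      obtain ⟨a, h2, h3⟩ := hs
      have h4 := Nat.Partrec.Code.evaln_sound h2
      have h5 : a ∈ c.eval (Encodable.encode ρ) := h4
      rw [hc] at h5
      simp at h5
      obtain ⟨σ', _, rfl⟩ := h5
      simp at h3
      subst h3
      exact h4

theorem exists_X {A : Set ℕ} (hA : CESet A) : ∃ X : ℕ → ℕ → Bool, Primrec₂ X ∧
    (∀ s t n, s ≤ t → X s n = true → X t n = true) ∧ ∀ n, n ∈ A ↔ ∃ s, X s n = true := by
  obtain ⟨f, hf, hA⟩ := hA
  obtain ⟨c, hc⟩ := Nat.Partrec.Code.exists_code.1 hf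
  refine ⟨fun s n => (Nat.Partrec.Code.evaln s c n).isSome, ?_, ?_, ?_⟩
  · exact Primrec.option_isSome.comp (Nat.Partrec.Code.primrec_evaln.comp
      (Primrec.pair (Primrec.pair Primrec.fst (Primrec.const c)) Primrec.snd))
  · intro s t n hst h
    simp only [Option.isSome_iff_exists] at h ⊢
    obtain ⟨a, h1⟩ := h
    exact ⟨a, Nat.Partrec.Code.evaln_mono hst h1⟩
  · intro n
    rw [hA, ← hc, Part.dom_iff_mem]
    simp only [Option.isSome_iff_exists]
    constructor
    · rintro ⟨y, hy⟩
      obtain ⟨s, hs⟩ := Nat.Partrec.Code.evaln_complete.1 hy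
      exact ⟨s, y, hs⟩
    · rintro ⟨s, y, hy⟩
      exact ⟨y, Nat.Partrec.Code.evaln_sound hy⟩

/-! ### The construction -/

abbrev Ent := (Str × ℕ) × ℕ
abbrev Leaf := ℕ × List Ent

def NN (e : ℕ) : ℕ := 2 ^ (2 * e + 5)
def hh (e : ℕ) : ℕ := 2 * e + 8
def gam (e : ℕ) (ν : List Ent) : ℕ := e + 3 + (ν.map fun x => hh e + x.1.1.length).sum
def kk (p : Leaf) : ℕ := gam p.1 p.2
def mm (p : Leaf) : ℕ := Encodable.encode p

def Xs (X : Bool → ℕ → ℕ → Bool) (b : Bool) (s m : ℕ) : Str := (List.range m).map (X b s)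

def strs (s : ℕ) : List Str := (List.range s).filterMap fun i => Encodable.decode i

section
variable (Us : ℕ → Str → Option Str) (X : Bool → ℕ → ℕ → Bool)

def okProg (ρ : Str) (b : Bool) (s : ℕ) (p : Leaf) : Prop :=
  ρ.length ≤ kk p + p.1 ∧ Us s ρ = Option.some (Xs X b s (mm p))

def lab (b : Bool) (s : ℕ) (p : Leaf) : Prop := ∃ ρ ∈ strs s, okProg Us X ρ b s p

noncomputable def vv : ℕ → Leaf → ℕ
  | 0, _ => 0
  | s + 1, p => if lab Us X (Nat.bodd (vv s p)) s p then vv s p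
      else if lab Us X (!(Nat.bodd (vv s p))) s p then vv s p + 1 else vv s p

noncomputable def cnt (L : List Leaf) (s e : ℕ) (ν : List Ent) (i : ℕ) : ℕ :=
  (L.map fun p => if p.1 = e ∧ ν <:+ p.2 ∧ i ≤ vv Us X s p then 2 ^ (s - kk p) else 0).sum

noncomputable def cntE (L : List Leaf) (s e : ℕ) (ν : List Ent) (i : ℕ) (b : Bool) : ℕ :=
  (L.map fun p => if p.1 = e ∧ ν <:+ p.2 ∧ vv Us X s p = i ∧ lab Us X b s p
    then 2 ^ (s - kk p) else 0).sum

def pairs (l : List Ent) : List (Ent × List Ent) :=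
  (List.range l.length).filterMap fun i => (l.drop i).head?.map fun x => (x, l.drop (i + 1))

/-- predecessor -/
def prd (x : Ent) : Ent := (x.1, x.2 - 1)

def okc (L : List Leaf) (s e : ℕ) (x : Ent) (ν : List Ent) : Prop :=
  (Us s x.1.1).map List.length = Option.some x.1.2 ∧
  cnt Us X L s e ν (NN e - ν.length) < 2 ^ (s - gam e ν) ∧
  (x.2 = 0 ∨ (2 ^ hh e - 1) * 2 ^ (s - gam e (prd x :: ν)) ≤
    2 ^ hh e * cnt Us X L s e (prd x :: ν) (NN e - ν.length))

def cnd (L : List Leaf) (s : ℕ) (p : Leaf) : Prop :=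
  p.2.length = NN p.1 ∧ p ∉ L ∧ kk p ≤ s ∧ ∀ q ∈ pairs p.2, okc Us X L s p.1 q.1 q.2

noncomputable def LL : ℕ → List Leaf
  | 0 => []
  | s + 1 => Option.casesOn (Encodable.decode (α := Leaf) s.unpair.1) (LL s)
      fun p => if cnd Us X (LL s) s p then p :: LL s else LL s

noncomputable def mainReq (t : ℕ) : Option (ℕ × Str) :=
  (LL Us X t).head?.map fun p => (kk p, zeroStr (mm p))

noncomputable def trivReq (e : ℕ) (ν : List Ent) (i c0 : ℕ) (b : Bool) (t : ℕ) : Option (ℕ × Str) :=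
  (Encodable.decode (α := Ent) t.unpair.1).bind fun x =>
    if (Us t.unpair.2 x.1.1).map List.length = Option.some x.1.2 ∧ gam e (x :: ν) ≤ t.unpair.2 ∧
      2 ^ (t.unpair.2 - gam e (x :: ν)) ≤
        2 ^ hh e * cntE Us X (LL Us X t.unpair.2) t.unpair.2 e (x :: ν) i b
    then Option.some (x.1.1.length + c0, Xs X b t.unpair.2 x.1.2) else Option.none

end

/-! ### Primitive recursiveness -/

theorem hh_primrec : Primrec hh :=
  Primrec.nat_add.comp (Primrec.nat_double) (Primrec.const 8)

theorem NN_primrec : Primrec NN :=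
  nat_pow_primrec.comp (Primrec.const 2)
    (Primrec.nat_add.comp (Primrec.nat_double) (Primrec.const 5))

theorem gam_primrec : Primrec₂ gam := by
  refine Primrec.nat_add.comp (Primrec.nat_add.comp Primrec.fst (Primrec.const 3)) ?_
  refine list_sum_primrec.comp (Primrec.list_map Primrec.snd ?_)
  exact Primrec.nat_add.comp (hh_primrec.comp (Primrec.fst.comp Primrec.fst))
    (Primrec.list_length.comp (Primrec.fst.comp (Primrec.fst.comp Primrec.snd)))

theorem kk_primrec : Primrec kk := gam_primrec.comp Primrec.fst Primrec.snd

theorem mm_primrec : Primrec mm := Primrec.encode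

theorem strs_primrec : Primrec strs :=
  Primrec.listFilterMap Primrec.list_range (Primrec.decode.comp Primrec.snd)

theorem suffix_primrec {α : Type*} [Primcodable α] :
    PrimrecRel (fun (a l : List α) => a <:+ l) := by
  have h : PrimrecRel (fun (a l : List α) => a = l.drop (l.length - a.length)) :=
    Primrec.eq.comp Primrec.fst (Primrec.list_drop.comp
      (Primrec.nat_sub.comp (Primrec.list_length.comp Primrec.snd)
        (Primrec.list_length.comp Primrec.fst)) Primrec.snd)
  exact h.of_eq (fun a l => List.suffix_iff_eq_drop.symm)

theorem pairs_primrec : Primrec pairs := by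
  refine Primrec.listFilterMap (Primrec.list_range.comp Primrec.list_length) ?_
  refine Primrec.option_map (Primrec.list_head?.comp
    (Primrec.list_drop.comp Primrec.snd Primrec.fst)) ?_
  exact Primrec.pair Primrec.snd (Primrec.list_drop.comp
    (Primrec.succ.comp (Primrec.snd.comp Primrec.fst)) (Primrec.fst.comp Primrec.fst))

theorem prd_primrec : Primrec prd :=
  Primrec.pair Primrec.fst (Primrec.nat_sub.comp Primrec.snd (Primrec.const 1))

theorem zeroStr_primrec : Primrec zeroStr := by
  refine (Primrec.list_map (f := fun n : ℕ => List.range n) (g := fun _ _ => false)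
    Primrec.list_range (Primrec.const false).to₂).of_eq ?_
  intro n
  simp [zeroStr]

section
variable {Us : ℕ → Str → Option Str} {X : Bool → ℕ → ℕ → Bool}

theorem Xs_primrec (hX : Primrec (fun q : Bool × ℕ × ℕ => X q.1 q.2.1 q.2.2)) :
    Primrec (fun q : Bool × ℕ × ℕ => Xs X q.1 q.2.1 q.2.2) := by
  refine Primrec.list_map (Primrec.list_range.comp (Primrec.snd.comp Primrec.snd)) ?_
  exact hX.comp (Primrec.pair (Primrec.fst.comp Primrec.fst)
    (Primrec.pair (Primrec.fst.comp (Primrec.snd.comp Primrec.fst)) Primrec.snd))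

theorem lab_primrec (hUs : Primrec₂ Us) (hX : Primrec (fun q : Bool × ℕ × ℕ => X q.1 q.2.1 q.2.2)) :
    PrimrecPred (fun q : Bool × ℕ × Leaf => lab Us X q.1 q.2.1 q.2.2) := by
  have h : PrimrecRel (fun (ρ : Str) (q : Bool × ℕ × Leaf) => okProg Us X ρ q.1 q.2.1 q.2.2) := by
    have hp : Primrec (fun r : Str × (Bool × ℕ × Leaf) => r.2.2.2) :=
      Primrec.snd.comp (Primrec.snd.comp Primrec.snd)
    have hs : Primrec (fun r : Str × (Bool × ℕ × Leaf) => r.2.2.1) :=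
      Primrec.fst.comp (Primrec.snd.comp Primrec.snd)
    refine PrimrecPred.and ?_ ?_
    · exact Primrec.nat_le.comp (Primrec.list_length.comp Primrec.fst)
        (Primrec.nat_add.comp (kk_primrec.comp hp) (Primrec.fst.comp hp))
    · exact Primrec.eq.comp (hUs.comp hs Primrec.fst) (Primrec.option_some.comp
        ((Xs_primrec hX).comp (Primrec.pair (Primrec.fst.comp Primrec.snd)
          (Primrec.pair hs (mm_primrec.comp hp)))))
  exact (PrimrecRel.exists_mem_list h).comp (strs_primrec.comp (Primrec.fst.comp Primrec.snd))
    Primrec.id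

theorem vv_primrec (hUs : Primrec₂ Us) (hX : Primrec (fun q : Bool × ℕ × ℕ => X q.1 q.2.1 q.2.2)) :
    Primrec₂ (vv Us X) := by
  have hl := lab_primrec hUs hX
  have hg : Primrec₂ (fun (p : Leaf) (q : ℕ × ℕ) =>
      if lab Us X (Nat.bodd q.2) q.1 p then q.2
      else if lab Us X (!(Nat.bodd q.2)) q.1 p then q.2 + 1 else q.2) := by
    have hp : Primrec (fun r : Leaf × (ℕ × ℕ) => r.1) := Primrec.fst
    have hs : Primrec (fun r : Leaf × (ℕ × ℕ) => r.2.1) := Primrec.fst.comp Primrec.snd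
    have hv : Primrec (fun r : Leaf × (ℕ × ℕ) => r.2.2) := Primrec.snd.comp Primrec.snd
    refine Primrec.ite (hl.comp (Primrec.pair (Primrec.nat_bodd.comp hv) (Primrec.pair hs hp))) hv ?_
    exact Primrec.ite (hl.comp (Primrec.pair ((Primrec.dom_bool not).comp (Primrec.nat_bodd.comp hv))
      (Primrec.pair hs hp))) (Primrec.succ.comp hv) hv
  refine ((Primrec.nat_rec (Primrec.const 0) hg).swap).of_eq ?_
  intro s p
  simp only [Function.swap]
  induction s with
  | zero => rfl
  | succ n ih => simp only [vv, ← ih]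

theorem cnt_primrec (hUs : Primrec₂ Us) (hX : Primrec (fun q : Bool × ℕ × ℕ => X q.1 q.2.1 q.2.2)) :
    Primrec (fun q : List Leaf × ℕ × ℕ × List Ent × ℕ =>
      cnt Us X q.1 q.2.1 q.2.2.1 q.2.2.2.1 q.2.2.2.2) := by
  refine list_sum_primrec.comp (Primrec.list_map Primrec.fst ?_)
  have hp : Primrec (fun r : (List Leaf × ℕ × ℕ × List Ent × ℕ) × Leaf => r.2) := Primrec.snd
  have hq : Primrec (fun r : (List Leaf × ℕ × ℕ × List Ent × ℕ) × Leaf => r.1.2) :=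
    Primrec.snd.comp Primrec.fst
  have hs := Primrec.fst.comp hq
  have he := Primrec.fst.comp (Primrec.snd.comp hq)
  have hν := Primrec.fst.comp (Primrec.snd.comp (Primrec.snd.comp hq))
  have hi := Primrec.snd.comp (Primrec.snd.comp (Primrec.snd.comp hq))
  refine Primrec.ite ?_ (nat_pow_primrec.comp (Primrec.const 2)
    (Primrec.nat_sub.comp hs (kk_primrec.comp hp))) (Primrec.const 0)
  refine PrimrecPred.and (Primrec.eq.comp (Primrec.fst.comp hp) he) ?_
  refine PrimrecPred.and (suffix_primrec.comp hν (Primrec.snd.comp hp)) ?_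
  exact Primrec.nat_le.comp hi ((vv_primrec hUs hX).comp hs hp)

theorem cntE_primrec (hUs : Primrec₂ Us) (hX : Primrec (fun q : Bool × ℕ × ℕ => X q.1 q.2.1 q.2.2))
    (b : Bool) :
    Primrec (fun q : List Leaf × ℕ × ℕ × List Ent × ℕ =>
      cntE Us X q.1 q.2.1 q.2.2.1 q.2.2.2.1 q.2.2.2.2 b) := by
  refine list_sum_primrec.comp (Primrec.list_map Primrec.fst ?_)
  have hp : Primrec (fun r : (List Leaf × ℕ × ℕ × List Ent × ℕ) × Leaf => r.2) := Primrec.snd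
  have hq : Primrec (fun r : (List Leaf × ℕ × ℕ × List Ent × ℕ) × Leaf => r.1.2) :=
    Primrec.snd.comp Primrec.fst
  have hs := Primrec.fst.comp hq
  have he := Primrec.fst.comp (Primrec.snd.comp hq)
  have hν := Primrec.fst.comp (Primrec.snd.comp (Primrec.snd.comp hq))
  have hi := Primrec.snd.comp (Primrec.snd.comp (Primrec.snd.comp hq))
  refine Primrec.ite ?_ (nat_pow_primrec.comp (Primrec.const 2)
    (Primrec.nat_sub.comp hs (kk_primrec.comp hp))) (Primrec.const 0)
  refine PrimrecPred.and (Primrec.eq.comp (Primrec.fst.comp hp) he) ?_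
  refine PrimrecPred.and (suffix_primrec.comp hν (Primrec.snd.comp hp)) ?_
  refine PrimrecPred.and (Primrec.eq.comp ((vv_primrec hUs hX).comp hs hp) hi) ?_
  exact (lab_primrec hUs hX).comp (Primrec.pair (Primrec.const b) (Primrec.pair hs hp))

theorem okc_primrec (hUs : Primrec₂ Us) (hX : Primrec (fun q : Bool × ℕ × ℕ => X q.1 q.2.1 q.2.2)) :
    PrimrecRel (fun (q : Ent × List Ent) (r : List Leaf × ℕ × ℕ) =>
      okc Us X r.1 r.2.1 r.2.2 q.1 q.2) := by
  have hx : Primrec (fun a : (Ent × List Ent) × (List Leaf × ℕ × ℕ) => a.1.1) :=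
    Primrec.fst.comp Primrec.fst
  have hν : Primrec (fun a : (Ent × List Ent) × (List Leaf × ℕ × ℕ) => a.1.2) :=
    Primrec.snd.comp Primrec.fst
  have hL : Primrec (fun a : (Ent × List Ent) × (List Leaf × ℕ × ℕ) => a.2.1) :=
    Primrec.fst.comp Primrec.snd
  have hs : Primrec (fun a : (Ent × List Ent) × (List Leaf × ℕ × ℕ) => a.2.2.1) :=
    Primrec.fst.comp (Primrec.snd.comp Primrec.snd)
  have he : Primrec (fun a : (Ent × List Ent) × (List Leaf × ℕ × ℕ) => a.2.2.2) :=
    Primrec.snd.comp (Primrec.snd.comp Primrec.snd)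
  have hlev := Primrec.nat_sub.comp (NN_primrec.comp he) (Primrec.list_length.comp hν)
  have hc := cnt_primrec hUs hX
  have hpx := Primrec.list_cons.comp (prd_primrec.comp hx) hν
  have h2 : ∀ {f : (Ent × List Ent) × (List Leaf × ℕ × ℕ) → ℕ}, Primrec f →
      Primrec (fun a => 2 ^ f a) := fun hf => nat_pow_primrec.comp (Primrec.const 2) hf
  refine PrimrecPred.and ?_ (PrimrecPred.and ?_ (PrimrecPred.or ?_ ?_))
  · exact Primrec.eq.comp (Primrec.option_map (hUs.comp hs (Primrec.fst.comp (Primrec.fst.comp hx)))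
      (Primrec.list_length.comp Primrec.snd).to₂)
      (Primrec.option_some.comp (Primrec.snd.comp (Primrec.fst.comp hx)))
  · exact Primrec.nat_lt.comp (hc.comp (Primrec.pair hL (Primrec.pair hs (Primrec.pair he
      (Primrec.pair hν hlev))))) (h2 (Primrec.nat_sub.comp hs (gam_primrec.comp he hν)))
  · exact Primrec.eq.comp (Primrec.snd.comp hx) (Primrec.const 0)
  · have hA1 := Primrec.nat_sub.comp (h2 (hh_primrec.comp he)) (Primrec.const 1)
    have hA2 := h2 (Primrec.nat_sub.comp hs (gam_primrec.comp he hpx))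
    have hA3 := hc.comp (Primrec.pair hL
        (Primrec.pair hs (Primrec.pair he (Primrec.pair hpx hlev))))
    have hA4 := h2 (hh_primrec.comp he)
    have hA5 := Primrec.nat_mul.comp hA1 hA2
    have hA6 := Primrec.nat_mul.comp hA4 hA3
    exact Primrec.nat_le.comp hA5 hA6

theorem cnd_primrec (hUs : Primrec₂ Us) (hX : Primrec (fun q : Bool × ℕ × ℕ => X q.1 q.2.1 q.2.2)) :
    PrimrecPred (fun q : List Leaf × ℕ × Leaf => cnd Us X q.1 q.2.1 q.2.2) := by
  have hL : Primrec (fun q : List Leaf × ℕ × Leaf => q.1) := Primrec.fst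
  have hs : Primrec (fun q : List Leaf × ℕ × Leaf => q.2.1) := Primrec.fst.comp Primrec.snd
  have hp : Primrec (fun q : List Leaf × ℕ × Leaf => q.2.2) := Primrec.snd.comp Primrec.snd
  refine PrimrecPred.and ?_ (PrimrecPred.and ?_ (PrimrecPred.and ?_ ?_))
  · exact Primrec.eq.comp (Primrec.list_length.comp (Primrec.snd.comp hp))
      (NN_primrec.comp (Primrec.fst.comp hp))
  · exact PrimrecPred.not (list_mem_primrec.comp hp hL)
  · exact Primrec.nat_le.comp (kk_primrec.comp hp) hs
  · exact (PrimrecRel.forall_mem_list (okc_primrec hUs hX)).comp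
      (pairs_primrec.comp (Primrec.snd.comp hp))
      (Primrec.pair hL (Primrec.pair hs (Primrec.fst.comp hp)))

theorem LL_primrec (hUs : Primrec₂ Us) (hX : Primrec (fun q : Bool × ℕ × ℕ => X q.1 q.2.1 q.2.2)) :
    Primrec (LL Us X) := by
  have : Primrec₂ (fun (s : ℕ) (L : List Leaf) =>
      (Option.casesOn (Encodable.decode (α := Leaf) s.unpair.1) L
        (fun p => if cnd Us X L s p then p :: L else L) : List Leaf)) := by
    refine Primrec.option_casesOn (Primrec.decode.comp
      (Primrec.fst.comp (Primrec.unpair.comp Primrec.fst))) Primrec.snd ?_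
    refine Primrec.ite ?_ (Primrec.list_cons.comp Primrec.snd (Primrec.snd.comp Primrec.fst))
      (Primrec.snd.comp Primrec.fst)
    exact (cnd_primrec hUs hX).comp (Primrec.pair (Primrec.snd.comp Primrec.fst)
      (Primrec.pair (Primrec.fst.comp Primrec.fst) Primrec.snd))
  refine (Primrec.nat_rec₁ [] this).of_eq ?_
  intro n
  induction n with
  | zero => rfl
  | succ n ih => simp only [LL, ← ih]

theorem mainReq_primrec (hUs : Primrec₂ Us)
    (hX : Primrec (fun q : Bool × ℕ × ℕ => X q.1 q.2.1 q.2.2)) : Primrec (mainReq Us X) := by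
  refine Primrec.option_map (Primrec.list_head?.comp (LL_primrec hUs hX)) ?_
  exact Primrec.pair (kk_primrec.comp Primrec.snd)
    (zeroStr_primrec.comp (mm_primrec.comp Primrec.snd))

theorem trivReq_primrec (hUs : Primrec₂ Us)
    (hX : Primrec (fun q : Bool × ℕ × ℕ => X q.1 q.2.1 q.2.2)) (e : ℕ) (ν : List Ent) (i c0 : ℕ)
    (b : Bool) : Primrec (trivReq Us X e ν i c0 b) := by
  refine Primrec.option_bind (Primrec.decode.comp (Primrec.fst.comp Primrec.unpair)) ?_
  have hs : Primrec (fun q : ℕ × Ent => q.1.unpair.2) :=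
    Primrec.snd.comp (Primrec.unpair.comp Primrec.fst)
  have hx : Primrec (fun q : ℕ × Ent => q.2) := Primrec.snd
  have hc := Primrec.list_cons.comp hx (Primrec.const ν)
  have hγ := gam_primrec.comp (Primrec.const e) hc
  refine Primrec.ite ?_ (Primrec.option_some.comp (Primrec.pair (Primrec.nat_add.comp
    (Primrec.list_length.comp (Primrec.fst.comp (Primrec.fst.comp hx))) (Primrec.const c0))
    ((Xs_primrec hX).comp (Primrec.pair (Primrec.const b)
      (Primrec.pair hs (Primrec.snd.comp (Primrec.fst.comp hx))))))) (Primrec.const Option.none)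
  refine PrimrecPred.and ?_ (PrimrecPred.and ?_ ?_)
  · exact Primrec.eq.comp (Primrec.option_map (hUs.comp hs (Primrec.fst.comp (Primrec.fst.comp hx)))
      (Primrec.list_length.comp Primrec.snd).to₂)
      (Primrec.option_some.comp (Primrec.snd.comp (Primrec.fst.comp hx)))
  · exact Primrec.nat_le.comp hγ hs
  · exact Primrec.nat_le.comp (nat_pow_primrec.comp (Primrec.const 2) (Primrec.nat_sub.comp hs hγ))
      (Primrec.nat_mul.comp (Primrec.const (2 ^ hh e)) ((cntE_primrec hUs hX b).comp
        (Primrec.pair ((LL_primrec hUs hX).comp hs) (Primrec.pair hs (Primrec.pair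
          (Primrec.const e) (Primrec.pair hc (Primrec.const i)))))))

end



/-- The standing assumptions on the approximations. -/
structure Ctx (U : Str →. Str) (S : Bool → Set ℕ) (Us : ℕ → Str → Option Str)
    (X : Bool → ℕ → ℕ → Bool) : Prop where
  um : ∀ s t ρ σ, s ≤ t → Us s ρ = Option.some σ → Us t ρ = Option.some σ
  umem : ∀ ρ σ, σ ∈ U ρ ↔ ∃ s, Us s ρ = Option.some σ
  pf : ∀ ρ₁ ρ₂ : Str, (U ρ₁).Dom → (U ρ₂).Dom → ρ₁ <+: ρ₂ → ρ₁ = ρ₂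
  xm : ∀ b s t n, s ≤ t → X b s n = true → X b t n = true
  xmem : ∀ b n, n ∈ S b ↔ ∃ s, X b s n = true

theorem mem_strs {ρ : Str} {s : ℕ} (h : Encodable.encode ρ < s) : ρ ∈ strs s := by
  simp only [strs, List.mem_filterMap, List.mem_range]
  exact ⟨_, h, by simp⟩

theorem strs_mono {ρ : Str} {s t : ℕ} (hst : s ≤ t) (h : ρ ∈ strs s) : ρ ∈ strs t := by
  simp only [strs, List.mem_filterMap, List.mem_range] at h ⊢
  obtain ⟨i, h1, h2⟩ := h
  exact ⟨i, by omega, h2⟩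

theorem mem_pairs {l : List Ent} {q : Ent × List Ent} : q ∈ pairs l ↔ (q.1 :: q.2) <:+ l := by
  obtain ⟨x, ν⟩ := q
  simp only [pairs, List.mem_filterMap, List.mem_range, Option.map_eq_some_iff, Prod.mk.injEq]
  constructor
  · rintro ⟨i, h1, y, h2, rfl, rfl⟩
    have h3 : l.drop i = y :: l.drop (i + 1) := by
      rw [← List.tail_drop]
      exact (List.cons_head?_tail h2).symm
    rw [← h3]
    exact List.drop_suffix _ _
  · rintro ⟨a, rfl⟩
    refine ⟨a.length, by simp, x, by simp, rfl, ?_⟩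
    rw [List.drop_append]
    simp

theorem gam_cons (e : ℕ) (x : Ent) (ν : List Ent) :
    gam e (x :: ν) = gam e ν + (hh e + x.1.1.length) := by
  simp [gam]; omega

theorem gam_suffix {e : ℕ} {ν l : List Ent} (h : ν <:+ l) : gam e ν ≤ gam e l := by
  obtain ⟨a, rfl⟩ := h
  simp [gam]

theorem mm_inj {p q : Leaf} (h : mm p = mm q) : p = q := Encodable.encode_injective h

theorem encode_mem_le {x : Ent} {l : List Ent} (h : x ∈ l) :
    Encodable.encode x ≤ Encodable.encode l := by
  induction l with
  | nil => simp at h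
  | cons a l ih =>
    rw [Encodable.encode_list_cons]
    rcases List.mem_cons.1 h with rfl | h
    · exact le_trans (Nat.left_le_pair _ _) (Nat.le_succ _)
    · exact le_trans (ih h) (le_trans (Nat.right_le_pair _ _) (Nat.le_succ _))

theorem le_mm {x : Ent} {p : Leaf} (h : x ∈ p.2) : x.1.2 ≤ mm p := by
  have h1 : Encodable.encode x ≤ mm p := by
    refine le_trans (encode_mem_le h) ?_
    unfold mm
    rw [Encodable.encode_prod_val]
    exact Nat.right_le_pair _ _
  refine le_trans ?_ h1
  rw [Encodable.encode_prod_val, Encodable.encode_prod_val]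
  refine le_trans ?_ (Nat.left_le_pair _ _)
  exact Nat.right_le_pair _ _

noncomputable def gg (e : ℕ) (ν : List Ent) : ℝ := (1/2 : ℝ) ^ gam e ν

theorem gg_pos (e ν) : 0 < gg e ν := by unfold gg; positivity

theorem gg_cons (e : ℕ) (x : Ent) (ν : List Ent) :
    gg e (x :: ν) = gg e ν * ((1/2) ^ hh e * (1/2) ^ x.1.1.length) := by
  simp only [gg, gam_cons, pow_add]

/-- the child entry of `ν` on the way to `l` -/
def chd (ν l : List Ent) : Ent := (l[l.length - ν.length - 1]?).getD default

theorem chd_iff {ν l : List Ent} (h : ν <:+ l) (hl : ν.length < l.length) (x : Ent) :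
    (x :: ν) <:+ l ↔ x = chd ν l := by
  obtain ⟨a, rfl⟩ := h
  rcases List.eq_nil_or_concat a with rfl | ⟨u, y, rfl⟩
  · simp at hl
  · have h1 : chd ν (u.concat y ++ ν) = y := by
      have h2 : (u.concat y ++ ν).length - ν.length - 1 = u.length := by simp; omega
      rw [chd, h2]
      simp
    rw [h1]
    constructor
    · rintro ⟨a, ha⟩
      have : (a ++ [x]) ++ ν = (u ++ [y]) ++ ν := by simpa using ha
      have := List.append_cancel_right this
      have h2 := List.append_inj' this rfl
      simpa using h2.2
    · rintro rfl
      exact ⟨u, by simp⟩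

theorem suffix_cons_inj {x y : Ent} {ν l : List Ent} (h : (x :: ν) <:+ l) (h' : (y :: ν) <:+ l) :
    x = y := by
  have h0 : ν <:+ l := (List.suffix_cons x ν).trans h
  have hl : ν.length < l.length := by
    have := h.length_le
    simp at this; omega
  rw [(chd_iff h0 hl x).1 h, (chd_iff h0 hl y).1 h']

theorem Xs_len (X : Bool → ℕ → ℕ → Bool) (b s m) : (Xs X b s m).length = m := by simp [Xs]

theorem Xs_ext {X : Bool → ℕ → ℕ → Bool} {b s t m} :
    Xs X b s m = Xs X b t m ↔ ∀ n < m, X b s n = X b t n := by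
  simp [Xs]

section
variable {U : Str →. Str} {S : Bool → Set ℕ} {Us : ℕ → Str → Option Str} {X : Bool → ℕ → ℕ → Bool}

theorem Xs_sandwich (C : Ctx U S Us X) {b t s s' m} (h1 : t ≤ s) (h2 : s ≤ s')
    (h : Xs X b s' m = Xs X b t m) : Xs X b s m = Xs X b t m := by
  rw [Xs_ext] at h ⊢
  intro n hn
  have a := C.xm b t s n h1
  have b' := C.xm b s s' n h2
  have c := h n hn
  cases ht : X b t n <;> cases hs : X b s n <;> simp_all

theorem Xs_limit (C : Ctx U S Us X) (b m) :
    ∀ᶠ s in atTop, Xs X b s m = restrSet (S b) m := by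
  have : ∀ n ∈ Finset.range m, ∀ᶠ s in atTop, X b s n = decide (n ∈ S b) := by
    intro n _
    by_cases hn : n ∈ S b
    · obtain ⟨t, ht⟩ := (C.xmem b n).1 hn
      filter_upwards [eventually_ge_atTop t] with s hs
      simp [hn, C.xm b t s n hs ht]
    · refine Eventually.of_forall fun s => ?_
      have := fun s => mt (fun h => (C.xmem b n).2 ⟨s, h⟩) hn
      simpa [hn] using this s
  have h2 := (Finset.eventually_all (Finset.range m)).2 this
  filter_upwards [h2] with s hs
  simp only [Xs, restrSet]
  refine List.map_congr_left fun n hn => ?_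
  exact hs n (by simpa using hn)

theorem Us_fun (C : Ctx U S Us X) {s t ρ σ τ} (h : Us s ρ = Option.some σ)
    (h' : Us t ρ = Option.some τ) : σ = τ := by
  have a := C.um s (max s t) ρ σ (le_max_left _ _) h
  have b := C.um t (max s t) ρ τ (le_max_right _ _) h'
  rw [a] at b
  cases b
  rfl

theorem lab_persist (C : Ctx U S Us X) {b t s p} (hts : t ≤ s) (h : lab Us X b t p)
    (hx : Xs X b s (mm p) = Xs X b t (mm p)) : lab Us X b s p := by
  obtain ⟨ρ, h1, h2, h3⟩ := h
  refine ⟨ρ, strs_mono hts h1, h2, ?_⟩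
  rw [hx]
  exact C.um t s _ _ hts h3

theorem lab_spec (C : Ctx U S Us X) {b s p} (h : lab Us X b s p) :
    ∃ ρ : Str, ρ.length ≤ kk p + p.1 ∧ Xs X b s (mm p) ∈ U ρ := by
  obtain ⟨ρ, h1, h2, h3⟩ := h
  exact ⟨ρ, h2, (C.umem _ _).2 ⟨s, h3⟩⟩

theorem lab_event (C : Ctx U S Us X) {b p} {ρ : Str} (h : ρ.length ≤ kk p + p.1)
    (h' : restrSet (S b) (mm p) ∈ U ρ) : ∀ᶠ s in atTop, lab Us X b s p := by
  obtain ⟨t, ht⟩ := (C.umem _ _).1 h'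
  filter_upwards [eventually_ge_atTop t, Xs_limit C b (mm p),
    eventually_gt_atTop (Encodable.encode ρ)] with s h1 h2 h3
  refine ⟨ρ, mem_strs h3, h, ?_⟩
  rw [h2]
  exact C.um t s _ _ h1 ht

theorem dom_kraft (C : Ctx U S Us X) (F : Finset Str) (hF : ∀ ρ ∈ F, (U ρ).Dom) :
    ∑ ρ ∈ F, (1/2 : ℝ) ^ ρ.length ≤ 1 :=
  kraft F fun ρ h ρ' h' => C.pf ρ ρ' (hF ρ h) (hF ρ' h')

theorem pay (C : Ctx U S Us X) {ι : Type*} (e : ℕ) (G : Finset ι) (P : ι → Leaf) (T : ι → Str)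
    (hinj : ∀ a ∈ G, ∀ b ∈ G, P a = P b → T a = T b → a = b)
    (hG : ∀ a ∈ G, (P a).1 = e ∧ (T a).length = mm (P a) ∧
      ∃ ρ : Str, ρ.length ≤ kk (P a) + (P a).1 ∧ T a ∈ U ρ) :
    ∑ a ∈ G, (1/2 : ℝ) ^ kk (P a) ≤ 2 ^ e := by
  have hex : ∀ a, ∃ ρ : Str, a ∈ G → ρ.length ≤ kk (P a) + (P a).1 ∧ T a ∈ U ρ := by
    intro a
    by_cases h : a ∈ G
    · obtain ⟨-, -, ρ, h1⟩ := hG a h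
      exact ⟨ρ, fun _ => h1⟩
    · exact ⟨[], fun h' => absurd h' h⟩
  choose R hR using hex
  have hRinj : ∀ a ∈ G, ∀ b ∈ G, R a = R b → a = b := by
    intro a ha b hb hab
    have h1 := (hR a ha).2
    have h2 := (hR b hb).2
    rw [hab] at h1
    have h3 := Part.mem_unique h1 h2
    refine hinj a ha b hb (mm_inj ?_) h3
    rw [← (hG a ha).2.1, ← (hG b hb).2.1, h3]
  have hk : ∑ ρ ∈ G.image R, (1/2 : ℝ) ^ ρ.length ≤ 1 := by
    refine dom_kraft C _ fun ρ hρ => ?_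
    obtain ⟨a, ha, rfl⟩ := Finset.mem_image.1 hρ
    exact Part.dom_iff_mem.2 ⟨_, (hR a ha).2⟩
  rw [Finset.sum_image hRinj] at hk
  calc ∑ a ∈ G, (1/2 : ℝ) ^ kk (P a) ≤ ∑ a ∈ G, 2 ^ e * (1/2 : ℝ) ^ (R a).length := by
        refine Finset.sum_le_sum fun a ha => ?_
        have h1 := (hR a ha).1
        rw [(hG a ha).1] at h1
        have h2 : (1/2 : ℝ) ^ (kk (P a) + e) ≤ (1/2 : ℝ) ^ (R a).length :=
          pow_le_pow_of_le_one (by norm_num) (by norm_num) h1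
        have h3 : (1/2 : ℝ) ^ kk (P a) = 2 ^ e * (1/2 : ℝ) ^ (kk (P a) + e) := by
          rw [pow_add, mul_comm, mul_assoc, ← mul_pow]; norm_num
        rw [h3]
        gcongr
    _ = 2 ^ e * ∑ a ∈ G, (1/2 : ℝ) ^ (R a).length := by rw [Finset.mul_sum]
    _ ≤ 2 ^ e * 1 := by gcongr
    _ = 2 ^ e := mul_one _

/-! ### The version counter -/

theorem vv_succ_cases (s p) : (vv Us X (s+1) p = vv Us X s p ∧
      (lab Us X (Nat.bodd (vv Us X s p)) s p ∨ ¬ lab Us X (!(Nat.bodd (vv Us X s p))) s p)) ∨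
    (vv Us X (s+1) p = vv Us X s p + 1 ∧ ¬ lab Us X (Nat.bodd (vv Us X s p)) s p ∧
      lab Us X (!(Nat.bodd (vv Us X s p))) s p) := by
  rw [vv]
  split_ifs with h1 h2
  · exact Or.inl ⟨rfl, Or.inl h1⟩
  · exact Or.inr ⟨rfl, h1, h2⟩
  · exact Or.inl ⟨rfl, Or.inr h2⟩

theorem vv_mono {s t p} (h : s ≤ t) : vv Us X s p ≤ vv Us X t p := by
  refine monotone_nat_of_le_succ (f := fun s => vv Us X s p) (fun n => ?_) h
  rcases vv_succ_cases (Us := Us) (X := X) n p with h | h <;> omega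

noncomputable def recS (Us : ℕ → Str → Option Str) (X : Bool → ℕ → ℕ → Bool)
    (b : Bool) (s : ℕ) (p : Leaf) : Finset Str :=
  ((Finset.range s).filter fun t => lab Us X b t p).image fun t => Xs X b t (mm p)

theorem mem_recS {b s p τ} : τ ∈ recS Us X b s p ↔ ∃ t < s, lab Us X b t p ∧ Xs X b t (mm p) = τ := by
  simp [recS, and_assoc]

theorem vv_rec (C : Ctx U S Us X) (s p) : ∃ R : Bool → Finset Str,
    (∀ b, R b ⊆ recS Us X b s p) ∧ vv Us X s p ≤ (R true).card + (R false).card ∧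
    ∀ τ ∈ R (!(Nat.bodd (vv Us X s p))), ∀ s' ≥ s, Xs X (!(Nat.bodd (vv Us X s p))) s' (mm p) ≠ τ := by
  induction s with
  | zero => exact ⟨fun _ => ∅, by simp, by simp [vv], by simp⟩
  | succ s ih =>
    obtain ⟨R, h1, h2, h3⟩ := ih
    have hmono : ∀ b, recS Us X b s p ⊆ recS Us X b (s+1) p := by
      intro b τ hτ
      rw [mem_recS] at hτ ⊢
      obtain ⟨t, a, b⟩ := hτ
      exact ⟨t, by omega, b⟩
    rcases vv_succ_cases (Us := Us) (X := X) s p with ⟨hv, -⟩ | ⟨hv, hn, hl⟩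
    · refine ⟨R, fun b => (h1 b).trans (hmono b), by omega, ?_⟩
      rw [hv]
      exact fun τ hτ s' hs' => h3 τ hτ s' (by omega)
    · rw [hv]
      simp only [Nat.bodd_succ, Bool.not_not]
      generalize Nat.bodd (vv Us X s p) = B at *
      have hnew : Xs X (!B) s (mm p) ∉ R (!B) := fun h => h3 _ h s le_rfl rfl
      refine ⟨Function.update R (!B) (insert (Xs X (!B) s (mm p)) (R (!B))), ?_, ?_, ?_⟩
      · intro b
        by_cases hb : b = !B
        · subst hb
          simp only [Function.update_self]
          refine Finset.insert_subset ?_ ((h1 _).trans (hmono _))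
          exact mem_recS.2 ⟨s, by omega, hl, rfl⟩
        · rw [Function.update_of_ne hb]
          exact (h1 _).trans (hmono _)
      · have := Finset.card_insert_of_notMem hnew
        cases B <;> simp [Function.update] at this ⊢ <;> omega
      · intro τ hτ s' hs'
        rw [Function.update_of_ne (by simp)] at hτ
        intro heq
        obtain ⟨t, ht, hlt, rfl⟩ := mem_recS.1 (h1 B hτ)
        refine hn (lab_persist C (t := t) (by omega) hlt ?_)
        exact Xs_sandwich C (by omega) (by omega : s ≤ s') heq

theorem vsum (C : Ctx U S Us X) (e s : ℕ) (F : Finset Leaf) (hF : ∀ p ∈ F, p.1 = e) :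
    ∑ p ∈ F, (1/2 : ℝ) ^ kk p * vv Us X s p ≤ 2 * 2 ^ e := by
  have hb : ∀ b, ∑ p ∈ F, (1/2 : ℝ) ^ kk p * (recS Us X b s p).card ≤ 2 ^ e := by
    intro b
    have := pay C e (F.sigma fun p => recS Us X b s p) (fun a => a.1) (fun a => a.2)
      (by rintro ⟨a, a'⟩ _ ⟨b, b'⟩ _ h1 h2; simp at h1 h2; simp [h1, h2])
      (by
        rintro ⟨p, τ⟩ h
        obtain ⟨hp, hτ⟩ := Finset.mem_sigma.1 h
        obtain ⟨t, _, hl, h2⟩ := mem_recS.1 hτ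
        simp only at h2 hl hp ⊢
        subst h2
        exact ⟨hF p hp, Xs_len _ _ _ _, lab_spec C hl⟩)
    rw [Finset.sum_sigma] at this
    refine le_trans (le_of_eq ?_) this
    refine Finset.sum_congr rfl fun p _ => ?_
    simp [mul_comm]
  calc ∑ p ∈ F, (1/2 : ℝ) ^ kk p * vv Us X s p
      ≤ ∑ p ∈ F, ((1/2 : ℝ) ^ kk p * (recS Us X true s p).card +
          (1/2 : ℝ) ^ kk p * (recS Us X false s p).card) := by
        refine Finset.sum_le_sum fun p _ => ?_
        rw [← mul_add]
        gcongr
        obtain ⟨R, h1, h2, -⟩ := vv_rec C s p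
        have a := Finset.card_le_card (h1 true)
        have b := Finset.card_le_card (h1 false)
        exact_mod_cast (by omega : vv Us X s p ≤ (recS Us X true s p).card + (recS Us X false s p).card)
    _ ≤ _ := by
        rw [Finset.sum_add_distrib]
        linarith [hb true, hb false]

theorem vv_bdd (C : Ctx U S Us X) (p) : ∃ B, ∀ s, vv Us X s p ≤ B := by
  refine ⟨2 * 2 ^ p.1 * 2 ^ kk p, fun s => ?_⟩
  have := vsum C p.1 s {p} (by simp)
  rw [Finset.sum_singleton] at this
  have h2 : (2:ℝ) ^ kk p * (1/2) ^ kk p = 1 := by rw [← mul_pow]; norm_num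
  have h3 : (0:ℝ) < 2 ^ kk p := by positivity
  have : (vv Us X s p : ℝ) ≤ 2 * 2 ^ p.1 * 2 ^ kk p := by
    calc (vv Us X s p : ℝ) = 2 ^ kk p * ((1/2) ^ kk p * vv Us X s p) := by
          rw [← mul_assoc, h2, one_mul]
      _ ≤ 2 ^ kk p * (2 * 2 ^ p.1) := by gcongr
      _ = _ := by ring
  exact_mod_cast this

theorem vv_stable (C : Ctx U S Us X) (p) : ∃ w, ∀ᶠ s in atTop, vv Us X s p = w := by
  obtain ⟨B, hB⟩ := vv_bdd C p
  have hne : (Set.range fun s => vv Us X s p).Nonempty := ⟨_, 0, rfl⟩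
  have hbd : BddAbove (Set.range fun s => vv Us X s p) := ⟨B, by rintro _ ⟨s, rfl⟩; exact hB s⟩
  obtain ⟨s0, hs0⟩ := Nat.sSup_mem hne hbd
  refine ⟨sSup (Set.range fun s => vv Us X s p), (eventually_ge_atTop s0).mono fun s hs => ?_⟩
  · exact le_antisymm (le_csSup hbd ⟨s, rfl⟩) (by rw [← hs0]; exact vv_mono hs)

end



section
variable {U : Str →. Str} {S : Bool → Set ℕ} {Us : ℕ → Str → Option Str} {X : Bool → ℕ → ℕ → Bool}

theorem LL_succ_cases (s : ℕ) : LL Us X (s+1) = LL Us X s ∨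
    ∃ p, cnd Us X (LL Us X s) s p ∧ LL Us X (s+1) = p :: LL Us X s := by
  rw [LL]
  cases h : (Encodable.decode (α := Leaf) s.unpair.1) with
  | none => exact Or.inl rfl
  | some p =>
    simp only
    split_ifs with h'
    · exact Or.inr ⟨p, h', rfl⟩
    · exact Or.inl rfl

theorem LL_add {s : ℕ} {p : Leaf} (h : s.unpair.1 = Encodable.encode p)
    (hc : cnd Us X (LL Us X s) s p) : LL Us X (s+1) = p :: LL Us X s := by
  rw [LL, h, Encodable.encodek]
  simp only [if_pos hc]

theorem LL_mono {s t : ℕ} (h : s ≤ t) : LL Us X s ⊆ LL Us X t := by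
  induction t, h using Nat.le_induction with
  | base => exact List.Subset.refl _
  | succ t _ ih =>
    rcases LL_succ_cases (Us := Us) (X := X) t with h | ⟨p, _, h⟩
    · rw [h]; exact ih
    · rw [h]; exact List.Subset.trans ih (List.subset_cons_self _ _)

theorem LL_nodup (s : ℕ) : (LL Us X s).Nodup := by
  induction s with
  | zero => simp [LL]
  | succ t ih =>
    rcases LL_succ_cases (Us := Us) (X := X) t with h | ⟨p, hc, h⟩
    · rw [h]; exact ih
    · rw [h]; exact List.nodup_cons.2 ⟨hc.2.1, ih⟩

theorem LL_origin {s : ℕ} {p : Leaf} (h : p ∈ LL Us X s) :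
    ∃ t < s, cnd Us X (LL Us X t) t p ∧ LL Us X (t+1) = p :: LL Us X t := by
  induction s with
  | zero => simp [LL] at h
  | succ s ih =>
    rcases LL_succ_cases (Us := Us) (X := X) s with h1 | ⟨q, hc, h1⟩
    · rw [h1] at h
      obtain ⟨t, a, b⟩ := ih h
      exact ⟨t, by omega, b⟩
    · rw [h1] at h
      rcases List.mem_cons.1 h with rfl | h
      · exact ⟨s, by omega, hc, h1⟩
      · obtain ⟨t, a, b⟩ := ih h
        exact ⟨t, by omega, b⟩

theorem LL_kk {s : ℕ} {p : Leaf} (h : p ∈ LL Us X s) : kk p ≤ s := by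
  obtain ⟨t, ht, hc, -⟩ := LL_origin h
  have := hc.2.2.1
  omega

theorem LL_len {s : ℕ} {p : Leaf} (h : p ∈ LL Us X s) : p.2.length = NN p.1 := by
  obtain ⟨t, ht, hc, -⟩ := LL_origin h
  exact hc.1

variable (Us X) in
/-- real weight -/
noncomputable def rW' (s : ℕ) (Q : Leaf → Prop) : ℝ :=
  ∑ p ∈ (LL Us X s).toFinset with Q p, (1/2 : ℝ) ^ kk p

variable (Us X) in
noncomputable def rcnt (s e : ℕ) (ν : List Ent) (i : ℕ) : ℝ :=
  rW' Us X s fun p => p.1 = e ∧ ν <:+ p.2 ∧ i ≤ vv Us X s p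

variable (Us X) in
noncomputable def rcntE (s e : ℕ) (ν : List Ent) (i : ℕ) (b : Bool) : ℝ :=
  rW' Us X s fun p => p.1 = e ∧ ν <:+ p.2 ∧ vv Us X s p = i ∧ lab Us X b s p

theorem rW_cast (s : ℕ) (Q : Leaf → Prop) :
    ((((LL Us X s).map fun p => if Q p then 2 ^ (s - kk p) else 0).sum : ℕ) : ℝ) =
      2 ^ s * rW' Us X s Q := by
  rw [rW', ← List.sum_toFinset _ (LL_nodup s), Finset.sum_filter]
  push_cast
  rw [Finset.mul_sum]
  refine Finset.sum_congr rfl fun p hp => ?_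
  have hk := LL_kk (List.mem_toFinset.1 hp)
  split_ifs
  · obtain ⟨d, rfl⟩ := Nat.exists_eq_add_of_le hk
    have : (2 : ℝ) ^ kk p * (1/2) ^ kk p = 1 := by rw [← mul_pow]; norm_num
    rw [show kk p + d - kk p = d by omega, pow_add]
    linear_combination (-(2:ℝ) ^ d) * this
  · simp

theorem cnt_cast (s e ν i) : (cnt Us X (LL Us X s) s e ν i : ℝ) = 2 ^ s * rcnt Us X s e ν i := by
  rw [rcnt, ← rW_cast, cnt]
  congr 2
  refine List.map_congr_left fun p _ => ?_
  split_ifs <;> rfl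

theorem cntE_cast (s e ν i b) :
    (cntE Us X (LL Us X s) s e ν i b : ℝ) = 2 ^ s * rcntE Us X s e ν i b := by
  rw [rcntE, ← rW_cast, cntE]
  congr 2
  refine List.map_congr_left fun p _ => ?_
  split_ifs <;> rfl

theorem two_gg {s e ν} (h : gam e ν ≤ s) : (2 : ℝ) ^ (s - gam e ν) = 2 ^ s * gg e ν := by
  obtain ⟨d, rfl⟩ := Nat.exists_eq_add_of_le h
  have : (2 : ℝ) ^ gam e ν * (1/2) ^ gam e ν = 1 := by rw [← mul_pow]; norm_num
  rw [show gam e ν + d - gam e ν = d by omega, pow_add, gg]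
  linear_combination (-(2:ℝ) ^ d) * this

theorem gam_prd (e x ν) : gam e (prd x :: ν) = gam e (x :: ν) := by
  simp [gam_cons, prd]

variable (Us X) in
/-- fullness of a child -/
def full (s e : ℕ) (x : Ent) (ν : List Ent) : Prop :=
  (1 - (1/2 : ℝ) ^ hh e) * gg e (x :: ν) ≤ rcnt Us X s e (x :: ν) (NN e - ν.length)

theorem okc_iff {s e x ν} (h : gam e (x :: ν) ≤ s) : okc Us X (LL Us X s) s e x ν ↔
    (Us s x.1.1).map List.length = Option.some x.1.2 ∧
    rcnt Us X s e ν (NN e - ν.length) < gg e ν ∧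
    (x.2 = 0 ∨ full Us X s e (prd x) ν) := by
  have hs : (0 : ℝ) < 2 ^ s := by positivity
  have hν : gam e ν ≤ s := le_trans (gam_suffix (List.suffix_cons x ν)) h
  have hp : gam e (prd x :: ν) ≤ s := by rw [gam_prd]; exact h
  have h1 : cnt Us X (LL Us X s) s e ν (NN e - ν.length) < 2 ^ (s - gam e ν) ↔
      rcnt Us X s e ν (NN e - ν.length) < gg e ν := by
    rw [← Nat.cast_lt (α := ℝ), cnt_cast]
    push_cast
    rw [two_gg hν]
    exact mul_lt_mul_iff_right₀ hs
  have h2 : (2 ^ hh e - 1) * 2 ^ (s - gam e (prd x :: ν)) ≤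
      2 ^ hh e * cnt Us X (LL Us X s) s e (prd x :: ν) (NN e - ν.length) ↔
      full Us X s e (prd x) ν := by
    rw [← Nat.cast_le (α := ℝ)]
    rw [Nat.cast_mul, Nat.cast_mul, Nat.cast_sub Nat.one_le_two_pow, cnt_cast]
    push_cast
    rw [two_gg hp, full]
    have hpos : (0:ℝ) < 2 ^ hh e * 2 ^ s := by positivity
    have e1 : (2 : ℝ) ^ hh e * (1/2) ^ hh e = 1 := by rw [← mul_pow]; norm_num
    rw [show ((2:ℝ) ^ hh e - 1) * (2 ^ s * gg e (prd x :: ν)) =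
      (2 ^ hh e * 2 ^ s) * ((1 - (1/2) ^ hh e) * gg e (prd x :: ν)) by
        linear_combination (2 ^ s * gg e (prd x :: ν)) * e1]
    rw [← mul_assoc ((2:ℝ) ^ hh e) (2 ^ s) (rcnt Us X s e (prd x :: ν) (NN e - ν.length))]
    exact mul_le_mul_iff_right₀ hpos
  rw [okc, h1, h2]

theorem rW'_mono {s t : ℕ} (h : s ≤ t) {Q R : Leaf → Prop} (hQ : ∀ p ∈ LL Us X s, Q p → R p) :
    rW' Us X s Q ≤ rW' Us X t R := by
  refine Finset.sum_le_sum_of_subset_of_nonneg ?_ (fun _ _ _ => by positivity)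
  intro p hp
  simp only [Finset.mem_filter, List.mem_toFinset] at hp ⊢
  exact ⟨LL_mono h hp.1, hQ p hp.1 hp.2⟩

theorem rcnt_mono {s t e ν i} (h : s ≤ t) : rcnt Us X s e ν i ≤ rcnt Us X t e ν i :=
  rW'_mono h fun _ _ hq => ⟨hq.1, hq.2.1, hq.2.2.trans (vv_mono h)⟩

theorem full_mono {s t e x ν} (h : s ≤ t) (hf : full Us X s e x ν) : full Us X t e x ν :=
  le_trans hf (rcnt_mono h)

theorem rcnt_nonneg {s e ν i} : 0 ≤ rcnt Us X s e ν i := by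
  unfold rcnt rW'
  exact Finset.sum_nonneg fun _ _ => by positivity

theorem eta_lt (e : ℕ) : (1/2 : ℝ) ^ hh e ≤ 1/256 := by
  have : (1/2 : ℝ) ^ hh e ≤ (1/2) ^ 8 :=
    pow_le_pow_of_le_one (by norm_num) (by norm_num) (by unfold hh; omega)
  norm_num at this ⊢
  exact this

theorem eta_pos (e : ℕ) : 0 < (1/2 : ℝ) ^ hh e := by positivity

/-- weights of distinct children add up to at most the weight of the parent -/
theorem rcnt_children {s e ν i} (Ch : Finset Ent) :
    ∑ x ∈ Ch, rcnt Us X s e (x :: ν) i ≤ rcnt Us X s e ν i := by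
  unfold rcnt rW'
  rw [← Finset.sum_biUnion]
  · refine Finset.sum_le_sum_of_subset_of_nonneg ?_ (fun _ _ _ => by positivity)
    intro p hp
    simp only [Finset.mem_biUnion, Finset.mem_filter] at hp ⊢
    obtain ⟨x, _, h1, h2, h3, h4⟩ := hp
    exact ⟨h1, h2, (List.suffix_cons x ν).trans h3, h4⟩
  · intro x _ y _ hxy
    simp only [Function.onFun]
    rw [Finset.disjoint_left]
    intro p h1 h2
    simp only [Finset.mem_filter] at h1 h2
    exact hxy (suffix_cons_inj h1.2.2.1 h2.2.2.1)

variable (Us X) in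
noncomputable def kids (s e : ℕ) (ν : List Ent) : Finset Ent :=
  ((LL Us X s).toFinset.filter fun p => p.1 = e ∧ ν <:+ p.2).image fun p => chd ν p.2

theorem mem_kids {s e ν x} (hν : ν.length < NN e) : x ∈ kids Us X s e ν ↔
    ∃ p ∈ LL Us X s, p.1 = e ∧ (x :: ν) <:+ p.2 := by
  simp only [kids, Finset.mem_image, Finset.mem_filter, List.mem_toFinset]
  constructor
  · rintro ⟨p, ⟨h1, h2, h3⟩, h4⟩
    refine ⟨p, h1, h2, ?_⟩
    rw [chd_iff h3 (by rw [LL_len h1, h2]; exact hν)]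
    exact h4.symm
  · rintro ⟨p, h1, h2, h3⟩
    have h4 := (List.suffix_cons x ν).trans h3
    refine ⟨p, ⟨h1, h2, h4⟩, ?_⟩
    exact ((chd_iff h4 (by rw [LL_len h1, h2]; exact hν) x).1 h3).symm

theorem rcnt_kids {s e ν i} (hν : ν.length < NN e) :
    rcnt Us X s e ν i = ∑ x ∈ kids Us X s e ν, rcnt Us X s e (x :: ν) i := by
  refine le_antisymm ?_ (rcnt_children _)
  unfold rcnt rW'
  rw [← Finset.sum_biUnion]
  · refine Finset.sum_le_sum_of_subset_of_nonneg ?_ (fun _ _ _ => by positivity)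
    intro p hp
    simp only [Finset.mem_biUnion, Finset.mem_filter, List.mem_toFinset] at hp ⊢
    obtain ⟨h1, h2, h3, h4⟩ := hp
    have h5 := (chd_iff h3 (by rw [LL_len h1, h2]; exact hν) (chd ν p.2)).2 rfl
    exact ⟨chd ν p.2, (mem_kids hν).2 ⟨p, h1, h2, h5⟩, h1, h2, h5, h4⟩
  · intro x _ y _ hxy
    simp only [Function.onFun]
    rw [Finset.disjoint_left]
    intro p h1 h2
    simp only [Finset.mem_filter] at h1 h2
    exact hxy (suffix_cons_inj h1.2.2.1 h2.2.2.1)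

/-- a child present at stage `s+1` satisfied its conditions at some stage `≤ s` -/
theorem kid_ok {s e ν x} (hν : ν.length < NN e) (hx : x ∈ kids Us X (s+1) e ν) : ∃ t ≤ s,
    (Us t x.1.1).map List.length = Option.some x.1.2 ∧ (x.2 = 0 ∨ full Us X t e (prd x) ν) := by
  obtain ⟨p, h1, h2, h3⟩ := (mem_kids hν).1 hx
  obtain ⟨t, ht, hc, -⟩ := LL_origin h1
  have h4 := hc.2.2.2 (x, ν) (mem_pairs.2 h3)
  subst h2
  rw [okc_iff (le_trans (gam_suffix h3) hc.2.2.1)] at h4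
  exact ⟨t, by omega, h4.1, h4.2.2⟩

theorem kid_chain {s e ν} (hν : ν.length < NN e) (a : Str × ℕ) (j : ℕ) :
    ∀ j', (a, j') ∈ kids Us X (s+1) e ν → j < j' → full Us X s e (a, j) ν := by
  intro j'
  induction j' with
  | zero => intro _ h; omega
  | succ j' ih =>
    intro hx hlt
    obtain ⟨t, ht, -, h⟩ := kid_ok hν hx
    rcases h with h | h
    · simp at h
    · have hp : prd (a, j' + 1) = (a, j') := by simp [prd]
      rw [hp] at h
      have h := full_mono ht h
      rcases Nat.lt_succ_iff_lt_or_eq.1 hlt with h1 | h1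
      · refine ih ?_ h1
        rw [mem_kids hν]
        by_contra hno
        push Not at hno
        have h0 : rcnt Us X s e ((a, j') :: ν) (NN e - ν.length) = 0 := by
          unfold rcnt rW'
          refine Finset.sum_eq_zero fun p hp => ?_
          exfalso
          simp only [Finset.mem_filter] at hp
          obtain ⟨hp, hq⟩ := hp
          exact hno p (LL_mono (Nat.le_succ s) (List.mem_toFinset.1 hp)) hq.1 hq.2.1
        rw [full, h0] at h
        have := gg_pos e ((a, j') :: ν)
        have := eta_lt e
        nlinarith
      · subst h1; exact h

theorem spend_step (C : Ctx U S Us X) {s e ν} (hν : ν.length < NN e) (κ : ℝ) (hκ : 0 ≤ κ)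
    (hκ2 : κ ≤ 2)
    (ih : ∀ x, rcnt Us X (s+1) e (x :: ν) 0 ≤ κ * gg e (x :: ν))
    (hret : rcnt Us X s e ν (NN e - ν.length) < gg e ν) :
    rcnt Us X (s+1) e ν 0 ≤ (κ + 6 * (1/2) ^ hh e) * gg e ν := by
  obtain ⟨η, hη⟩ : ∃ η : ℝ, η = (1/2) ^ hh e := ⟨_, rfl⟩
  have η1 : η ≤ 1/256 := hη ▸ eta_lt e
  have η0 : 0 < η := hη ▸ eta_pos e
  rw [← hη]
  have hg := gg_pos e ν
  set K := kids Us X (s+1) e ν with hK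
  have hfull : ∑ x ∈ K with full Us X s e x ν, gg e (x :: ν) ≤ (1 + 2 * η) * gg e ν := by
    have h1 : ∑ x ∈ K with full Us X s e x ν, (1 - η) * gg e (x :: ν) ≤ gg e ν := by
      refine le_trans ?_ hret.le
      refine le_trans ?_ (rcnt_children (K.filter fun x => full Us X s e x ν))
      refine Finset.sum_le_sum fun x hx => ?_
      rw [hη]
      exact (Finset.mem_filter.1 hx).2
    rw [← Finset.mul_sum] at h1
    have h2 : 1 ≤ (1 + 2 * η) * (1 - η) := by nlinarith
    have hY : 0 ≤ ∑ x ∈ K with full Us X s e x ν, gg e (x :: ν) :=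
      Finset.sum_nonneg fun x _ => (gg_pos _ _).le
    generalize ∑ x ∈ K with full Us X s e x ν, gg e (x :: ν) = Y at *
    calc Y = 1 * Y := (one_mul _).symm
      _ ≤ (1 + 2 * η) * (1 - η) * Y := mul_le_mul_of_nonneg_right h2 hY
      _ = (1 + 2 * η) * ((1 - η) * Y) := by ring
      _ ≤ _ := mul_le_mul_of_nonneg_left h1 (by linarith)
  have hnon : ∑ x ∈ K with ¬ full Us X s e x ν, gg e (x :: ν) ≤ η * gg e ν := by
    have hinj : ∀ x ∈ K.filter (fun x => ¬ full Us X s e x ν),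
        ∀ y ∈ K.filter (fun x => ¬ full Us X s e x ν), x.1.1 = y.1.1 → x = y := by
      rintro ⟨⟨ρ, n⟩, j⟩ hx ⟨⟨ρ', n'⟩, j'⟩ hy h
      simp only at h
      subst h
      obtain ⟨hx1, hx2⟩ := Finset.mem_filter.1 hx
      obtain ⟨hy1, hy2⟩ := Finset.mem_filter.1 hy
      obtain ⟨t, -, a, -⟩ := kid_ok hν hx1
      obtain ⟨t', -, a', -⟩ := kid_ok hν hy1
      simp only [Option.map_eq_some_iff] at a a'
      obtain ⟨σ, b1, b2⟩ := a
      obtain ⟨σ', b1', b2'⟩ := a'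
      have := Us_fun C b1 b1'
      subst this
      have hn : n = n' := by rw [← b2, ← b2']
      subst hn
      rcases lt_trichotomy j j' with h | h | h
      · exact absurd (kid_chain hν _ j j' hy1 h) hx2
      · rw [h]
      · exact absurd (kid_chain hν _ j' j hx1 h) hy2
    have hk := dom_kraft C ((K.filter (fun x => ¬ full Us X s e x ν)).image fun x => x.1.1) (by
      intro ρ hρ
      obtain ⟨x, hx, rfl⟩ := Finset.mem_image.1 hρ
      obtain ⟨t, -, a, -⟩ := kid_ok hν (Finset.mem_filter.1 hx).1
      simp only [Option.map_eq_some_iff] at a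
      obtain ⟨σ, b1, b2⟩ := a
      exact Part.dom_iff_mem.2 ⟨σ, (C.umem _ _).2 ⟨t, b1⟩⟩)
    rw [Finset.sum_image hinj] at hk
    simp only [gg_cons]
    rw [← Finset.mul_sum, ← Finset.mul_sum]
    calc _ ≤ gg e ν * ((1/2) ^ hh e * 1) := by gcongr
      _ = η * gg e ν := by rw [hη]; ring
  rw [rcnt_kids hν, ← hK]
  calc ∑ x ∈ K, rcnt Us X (s+1) e (x :: ν) 0 ≤ ∑ x ∈ K, κ * gg e (x :: ν) :=
        Finset.sum_le_sum fun x _ => ih x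
    _ = κ * (∑ x ∈ K with full Us X s e x ν, gg e (x :: ν) +
          ∑ x ∈ K with ¬ full Us X s e x ν, gg e (x :: ν)) := by
        rw [Finset.sum_filter_add_sum_filter_not, Finset.mul_sum]
    _ ≤ κ * ((1 + 2 * η) * gg e ν + η * gg e ν) := by gcongr
    _ = (κ + κ * (3 * η)) * gg e ν := by ring
    _ ≤ (κ + 2 * (3 * η)) * gg e ν := by gcongr
    _ = _ := by ring

theorem kappa_le {e i : ℕ} (h : i ≤ NN e) : 1 + 6 * (1/2 : ℝ) ^ hh e * i ≤ 2 := by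
  have h1 : (i : ℝ) ≤ 2 ^ (2 * e + 5) := by exact_mod_cast h
  have h2 : (1/2 : ℝ) ^ hh e * 2 ^ (2 * e + 5) = 1/8 := by
    rw [hh, show 2 * e + 8 = (2 * e + 5) + 3 by ring, pow_add, mul_right_comm, ← mul_pow]
    norm_num
  have := eta_pos e
  nlinarith

theorem spend (C : Ctx U S Us X) (e : ℕ) : ∀ i s (ν : List Ent), ν.length + i = NN e →
    rcnt Us X s e ν 0 ≤ (1 + 6 * (1/2) ^ hh e * i) * gg e ν := by
  intro i
  induction i with
  | zero =>
    intro s ν hν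
    simp only [Nat.cast_zero, mul_zero, add_zero, one_mul]
    unfold rcnt rW'
    calc _ ≤ ∑ p ∈ {(e, ν)}, (1/2 : ℝ) ^ kk p := by
          refine Finset.sum_le_sum_of_subset_of_nonneg ?_ (fun _ _ _ => by positivity)
          intro p hp
          simp only [Finset.mem_filter, List.mem_toFinset, Finset.mem_singleton] at hp ⊢
          obtain ⟨h1, h2, h3, -⟩ := hp
          have := h3.eq_of_length (by rw [LL_len h1, h2]; omega)
          ext1
          · exact h2
          · exact this.symm
      _ = _ := by simp [kk, gg]
  | succ i ih =>
    intro s ν hν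
    have hlt : ν.length < NN e := by omega
    induction s with
    | zero =>
      have : rcnt Us X 0 e ν 0 = 0 := by simp [rcnt, rW', LL]
      rw [this]
      have := gg_pos e ν
      positivity
    | succ s ihs =>
      rcases LL_succ_cases (Us := Us) (X := X) s with h | ⟨p, hc, h⟩
      · have : rcnt Us X (s+1) e ν 0 = rcnt Us X s e ν 0 := by
          simp [rcnt, rW', h]
        rw [this]; exact ihs
      · by_cases hp : p.1 = e ∧ ν <:+ p.2
        · have hx := (chd_iff hp.2 (by rw [hc.1, hp.1]; exact hlt) (chd ν p.2)).2 rfl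
          have hok := hc.2.2.2 (chd ν p.2, ν) (mem_pairs.2 hx)
          rw [okc_iff (le_trans (gam_suffix hx) hc.2.2.1), hp.1] at hok
          have := spend_step C (s := s) hlt (1 + 6 * (1/2) ^ hh e * i) (by positivity)
            (kappa_le (by omega)) (fun x => ih (s+1) (x :: ν) (by simp; omega)) hok.2.1
          refine le_trans this (le_of_eq ?_)
          push_cast
          ring
        · have : rcnt Us X (s+1) e ν 0 = rcnt Us X s e ν 0 := by
            unfold rcnt rW'
            simp only [zero_le, and_true]
            rw [h, List.toFinset_cons, Finset.filter_insert, if_neg hp]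
          rw [this]; exact ihs

theorem total (C : Ctx U S Us X) (s : ℕ) :
    ∑ p ∈ (LL Us X s).toFinset, (1/2 : ℝ) ^ kk p ≤ 1/2 := by
  set E := (LL Us X s).toFinset.image fun p => p.1 with hE
  have h1 : ∑ p ∈ (LL Us X s).toFinset, (1/2 : ℝ) ^ kk p = ∑ e ∈ E, rcnt Us X s e [] 0 := by
    rw [← Finset.sum_fiberwise_of_maps_to (t := E) (g := fun p => p.1)
      (fun p hp => Finset.mem_image_of_mem _ hp)]
    refine Finset.sum_congr rfl fun e _ => ?_
    simp [rcnt, rW']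
  rw [h1]
  calc ∑ e ∈ E, rcnt Us X s e [] 0 ≤ ∑ e ∈ E, (1/4) * (1/2 : ℝ) ^ e := by
        refine Finset.sum_le_sum fun e _ => ?_
        refine le_trans (spend C e (NN e) s [] (by simp)) ?_
        have h2 := kappa_le (e := e) le_rfl
        have h3 : gg e [] = (1/8) * (1/2) ^ e := by
          simp [gg, gam, pow_add]; ring
        have h4 := gg_pos e []
        calc _ ≤ 2 * gg e [] := by gcongr
          _ = _ := by rw [h3]; ring
    _ = (1/4) * ∑ e ∈ E, (1/2 : ℝ) ^ e := by rw [Finset.mul_sum]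
    _ ≤ (1/4) * 2 := by
        gcongr
        have h5 := summable_geometric_two.sum_le_tsum E (fun _ _ => by positivity)
        rw [tsum_geometric_two] at h5
        exact h5
    _ = 1/2 := by norm_num

theorem main_weight (C : Ctx U S Us X) (F : Finset (ℕ × Str))
    (hF : ∀ r ∈ F, ∃ t, mainReq Us X t = Option.some r) : ∑ r ∈ F, (1/2 : ℝ) ^ r.1 ≤ 1/2 := by
  have h1 : ∀ r ∈ F, ∃ t p, p ∈ LL Us X t ∧ r = (kk p, zeroStr (mm p)) := by
    intro r hr
    obtain ⟨t, ht⟩ := hF r hr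
    simp only [mainReq, Option.map_eq_some_iff] at ht
    obtain ⟨p, h1, h2⟩ := ht
    exact ⟨t, p, List.mem_of_mem_head? h1, h2.symm⟩
  have h2 : ∀ r, ∃ t p, r ∈ F → p ∈ LL Us X t ∧ r = (kk p, zeroStr (mm p)) := by
    intro r
    by_cases h : r ∈ F
    · obtain ⟨t, p, h2⟩ := h1 r h
      exact ⟨t, p, fun _ => h2⟩
    · exact ⟨0, (0, []), fun h' => absurd h' h⟩
  choose t p hp using h2
  have hinj : ∀ r ∈ F, ∀ r' ∈ F, p r = p r' → r = r' := by
    intro r hr r' hr' h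
    rw [(hp r hr).2, (hp r' hr').2, h]
  refine le_trans ?_ (total C (F.sup t))
  calc ∑ r ∈ F, (1/2 : ℝ) ^ r.1 = ∑ r ∈ F, (1/2 : ℝ) ^ kk (p r) := by
        refine Finset.sum_congr rfl fun r hr => ?_
        conv_lhs => rw [(hp r hr).2]
    _ = ∑ q ∈ F.image p, (1/2 : ℝ) ^ kk q := by rw [Finset.sum_image hinj]
    _ ≤ _ := by
        refine Finset.sum_le_sum_of_subset_of_nonneg ?_ (fun _ _ _ => by positivity)
        intro q hq
        obtain ⟨r, hr, rfl⟩ := Finset.mem_image.1 hq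
        exact List.mem_toFinset.2 (LL_mono (Finset.le_sup hr) (hp r hr).1)

end


section
variable {U : Str →. Str} {S : Bool → Set ℕ} {Us : ℕ → Str → Option Str} {X : Bool → ℕ → ℕ → Bool}

theorem cntE_iff {s e x ν i b} (h : gam e (x :: ν) ≤ s) :
    2 ^ (s - gam e (x :: ν)) ≤ 2 ^ hh e * cntE Us X (LL Us X s) s e (x :: ν) i b ↔
    (1/2 : ℝ) ^ hh e * gg e (x :: ν) ≤ rcntE Us X s e (x :: ν) i b := by
  rw [← Nat.cast_le (α := ℝ)]
  push_cast
  rw [cntE_cast, two_gg h]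
  have hpos : (0:ℝ) < 2 ^ hh e * 2 ^ s := by positivity
  have e1 : (2 : ℝ) ^ hh e * (1/2) ^ hh e = 1 := by rw [← mul_pow]; norm_num
  rw [show (2:ℝ) ^ s * gg e (x :: ν) =
    (2 ^ hh e * 2 ^ s) * ((1/2) ^ hh e * gg e (x :: ν)) by
      linear_combination (-2 ^ s * gg e (x :: ν)) * e1]
  rw [← mul_assoc ((2:ℝ) ^ hh e) (2 ^ s) (rcntE Us X s e (x :: ν) i b)]
  exact mul_le_mul_iff_right₀ hpos

theorem trivReq_iff {e ν i c0 b t r} : trivReq Us X e ν i c0 b t = Option.some r ↔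
    ∃ x : Ent, Encodable.decode (α := Ent) t.unpair.1 = Option.some x ∧
      (Us t.unpair.2 x.1.1).map List.length = Option.some x.1.2 ∧ gam e (x :: ν) ≤ t.unpair.2 ∧
      (1/2 : ℝ) ^ hh e * gg e (x :: ν) ≤ rcntE Us X t.unpair.2 e (x :: ν) i b ∧
      r = (x.1.1.length + c0, Xs X b t.unpair.2 x.1.2) := by
  unfold trivReq
  rw [Option.bind_eq_some_iff]
  refine exists_congr fun x => and_congr_right fun _ => ?_
  constructor
  · intro h
    split_ifs at h with h1
    simp only [Option.some.injEq] at h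
    rw [cntE_iff h1.2.1] at h1
    exact ⟨h1.1, h1.2.1, h1.2.2, h.symm⟩
  · rintro ⟨h1, h2, h3, rfl⟩
    rw [← cntE_iff h2] at h3
    rw [if_pos ⟨h1, h2, h3⟩]

theorem triv_weight (C : Ctx U S Us X) (e ν i b) (F : Finset (ℕ × Str))
    (hF : ∀ r ∈ F, ∃ t, trivReq Us X e ν i (e + 1 + (2 * hh e + gam e ν)) b t = Option.some r) :
    ∑ r ∈ F, (1/2 : ℝ) ^ r.1 ≤ 1/2 := by
  have h2 : ∀ r, ∃ (s : ℕ) (x : Ent), r ∈ F →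
      (1/2 : ℝ) ^ hh e * gg e (x :: ν) ≤ rcntE Us X s e (x :: ν) i b ∧
      r = (x.1.1.length + (e + 1 + (2 * hh e + gam e ν)), Xs X b s x.1.2) := by
    intro r
    by_cases h : r ∈ F
    · obtain ⟨t, ht⟩ := hF r h
      obtain ⟨x, -, -, -, a, b⟩ := trivReq_iff.1 ht
      exact ⟨_, x, fun _ => ⟨a, b⟩⟩
    · exact ⟨0, default, fun h' => absurd h' h⟩
  choose s x hr using h2
  have hpay := pay C e (F.sigma fun r => (LL Us X (s r)).toFinset.filter fun p =>
      p.1 = e ∧ (x r :: ν) <:+ p.2 ∧ vv Us X (s r) p = i ∧ lab Us X b (s r) p)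
    (fun a => a.2) (fun a => Xs X b (s a.1) (mm a.2)) (by
      rintro ⟨r, p⟩ h ⟨r', p'⟩ h' hp hT
      simp only at hp hT
      subst hp
      simp only [Finset.mem_sigma, Finset.mem_filter] at h h'
      have hx := suffix_cons_inj h.2.2.2.1 h'.2.2.2.1
      have hm : (x r).1.2 ≤ mm p := le_mm (h.2.2.2.1.subset (by simp))
      have hX : Xs X b (s r) (x r).1.2 = Xs X b (s r') (x r).1.2 := by
        rw [Xs_ext] at hT ⊢
        exact fun n hn => hT n (by omega)
      have : r = r' := by
        rw [(hr r h.1).2, (hr r' h'.1).2, ← hx, hX]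
      rw [this]) (by
      rintro ⟨r, p⟩ h
      simp only [Finset.mem_sigma, Finset.mem_filter] at h
      exact ⟨h.2.2.1, Xs_len _ _ _ _, lab_spec C h.2.2.2.2.2⟩)
  rw [Finset.sum_sigma] at hpay
  have hpay2 : ∑ r ∈ F, rcntE Us X (s r) e (x r :: ν) i b ≤ 2 ^ e := by
    refine le_trans (le_of_eq ?_) hpay
    refine Finset.sum_congr rfl fun r _ => ?_
    unfold rcntE rW'
    refine Finset.sum_congr ?_ fun _ _ => rfl
    ext p
    simp only [Finset.mem_filter]
  calc ∑ r ∈ F, (1/2 : ℝ) ^ r.1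
      ≤ ∑ r ∈ F, (1/2 : ℝ) ^ (e + 1) * rcntE Us X (s r) e (x r :: ν) i b := by
        refine Finset.sum_le_sum fun r h => ?_
        obtain ⟨h1, h2⟩ := hr r h
        have h3 : (1/2 : ℝ) ^ r.1 = (1/2) ^ (e + 1) * ((1/2 : ℝ) ^ hh e * gg e (x r :: ν)) := by
          have : r.1 = (x r).1.1.length + (e + 1 + (2 * hh e + gam e ν)) := by
            conv_lhs => rw [h2]
          rw [this, gg_cons, gg, pow_add _ (x r).1.1.length, pow_add _ (e + 1), pow_add _ (2 * hh e),
            two_mul, pow_add _ (hh e)]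
          ring
        rw [h3]
        exact mul_le_mul_of_nonneg_left h1 (by positivity)
    _ = (1/2 : ℝ) ^ (e + 1) * ∑ r ∈ F, rcntE Us X (s r) e (x r :: ν) i b := by
        rw [Finset.mul_sum]
    _ ≤ (1/2 : ℝ) ^ (e + 1) * 2 ^ e := mul_le_mul_of_nonneg_left hpay2 (by positivity)
    _ = 1/2 := by
        rw [pow_succ, mul_right_comm, ← mul_pow]; norm_num

/-! ### Termination -/

variable (Us X) in
def live (e : ℕ) (ν : List Ent) : Prop :=
  ∀ᶠ s in atTop, ∀ q, (q : Ent × List Ent).1 :: q.2 <:+ ν → okc Us X (LL Us X s) s e q.1 q.2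

variable (Us X) in
def ret (e : ℕ) (ν : List Ent) : Prop := ∃ s, gg e ν ≤ rcnt Us X s e ν (NN e - ν.length)

variable (U S Us X) in
/-- every requested leaf of strategy `e` eventually gets a label -/
def answered (e : ℕ) : Prop := ∀ p t, p ∈ LL Us X t → p.1 = e →
  ∃ b, ∃ ρ : Str, ρ.length ≤ kk p + p.1 ∧ restrSet (S b) (mm p) ∈ U ρ

theorem single_le {s e ν i} {p : Leaf} (hp : p ∈ LL Us X s) (he : p.1 = e) (hν : ν <:+ p.2)
    (hi : i ≤ vv Us X s p) : (1/2 : ℝ) ^ kk p ≤ rcnt Us X s e ν i := by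
  unfold rcnt rW'
  refine Finset.single_le_sum (f := fun p => (1/2 : ℝ) ^ kk p) (fun _ _ => by positivity) ?_
  simp only [Finset.mem_filter, List.mem_toFinset]
  exact ⟨hp, he, hν, hi⟩

theorem leaf_ret {e ν} (hν : ν.length = NN e) (hl : live Us X e ν) : ret Us X e ν := by
  obtain ⟨s0, hs0⟩ := eventually_atTop.1 hl
  have : ∃ s, (e, ν) ∈ LL Us X s := by
    by_contra hno
    push Not at hno
    set s := Nat.pair (Encodable.encode ((e, ν) : Leaf)) (max s0 (gam e ν)) with hs
    have h1 : max s0 (gam e ν) ≤ s := Nat.right_le_pair _ _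
    have hc : cnd Us X (LL Us X s) s (e, ν) := by
      refine ⟨hν, hno s, le_trans (le_max_right _ _) h1, ?_⟩
      intro q hq
      exact hs0 s (le_trans (le_max_left _ _) h1) q (mem_pairs.1 hq)
    have h2 := LL_add (s := s) (p := (e, ν)) (by rw [hs, Nat.unpair_pair]) hc
    exact hno (s+1) (by rw [h2]; simp)
  obtain ⟨s, hs⟩ := this
  refine ⟨s, ?_⟩
  exact single_le (p := (e, ν)) hs rfl List.suffix_rfl (by omega)

/-- If a child is returned but never full, then its weight with current version exactly `i` is
eventually large. -/
theorem stuck (C : Ctx U S Us X) {e ν x i} (hans : answered U S Us X e)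
    (hi : ν.length + (i + 1) = NN e) (hret : ret Us X e (x :: ν))
    (hnf : ∀ s, ¬ full Us X s e x ν) :
    ∀ᶠ s in atTop, (1/2 : ℝ) ^ hh e * gg e (x :: ν) ≤ rcntE Us X s e (x :: ν) i (Nat.bodd i) := by
  obtain ⟨s0, hs0⟩ := hret
  rw [show NN e - (x :: ν).length = i by simp; omega] at hs0
  have hnf' : ∀ s, rcnt Us X s e (x :: ν) (i + 1) < (1 - (1/2 : ℝ) ^ hh e) * gg e (x :: ν) := by
    intro s
    have := hnf s
    rw [full, show NN e - ν.length = i + 1 by omega] at this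
    exact not_le.1 this
  have hst : ∀ p ∈ (LL Us X s0).toFinset, ∀ᶠ s in atTop, p.1 = e →
      (vv Us X (s+1) p = vv Us X s p ∧ (lab Us X true s p ∨ lab Us X false s p)) := by
    intro p hp
    by_cases hpe : p.1 = e
    · obtain ⟨w, hw⟩ := vv_stable C p
      have hw2 := (tendsto_add_atTop_nat 1).eventually hw
      obtain ⟨b, ρ, h1, h2⟩ := hans p s0 (List.mem_toFinset.1 hp) hpe
      filter_upwards [hw, hw2, lab_event C h1 h2] with s a1 a2 a3 _
      refine ⟨by rw [a1, a2], ?_⟩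
      cases b
      · exact Or.inr a3
      · exact Or.inl a3
    · exact Eventually.of_forall fun s h => absurd h hpe
  filter_upwards [(Finset.eventually_all _).2 hst, eventually_ge_atTop s0] with s hs hge
  have key : rcnt Us X s0 e (x :: ν) i ≤
      rcntE Us X s e (x :: ν) i (Nat.bodd i) + rcnt Us X s e (x :: ν) (i + 1) := by
    unfold rcnt rcntE rW'
    rw [← Finset.sum_union]
    · refine Finset.sum_le_sum_of_subset_of_nonneg ?_ (fun _ _ _ => by positivity)
      intro p hp
      simp only [Finset.mem_union, Finset.mem_filter, List.mem_toFinset] at hp ⊢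
      obtain ⟨h1, h2, h3, h4⟩ := hp
      have h5 := le_trans h4 (vv_mono (Us := Us) (X := X) (p := p) hge)
      have hmem := LL_mono hge h1
      rcases Nat.lt_or_ge i (vv Us X s p) with h6 | h6
      · exact Or.inr ⟨hmem, h2, h3, h6⟩
      · have h7 : vv Us X s p = i := le_antisymm h6 h5
        refine Or.inl ⟨hmem, h2, h3, h7, ?_⟩
        obtain ⟨h8, h9⟩ := hs p (List.mem_toFinset.2 h1) h2
        rcases vv_succ_cases (Us := Us) (X := X) s p with ⟨-, h10⟩ | ⟨h10, -⟩
        · rw [h7] at h10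
          rcases h10 with h10 | h10
          · exact h10
          · generalize Nat.bodd i = B at *
            cases B
            · simp only [Bool.not_false] at h10
              exact h9.resolve_left h10
            · simp only [Bool.not_true] at h10
              exact h9.resolve_right h10
        · omega
    · rw [Finset.disjoint_left]
      intro p h1 h2
      simp only [Finset.mem_filter] at h1 h2
      omega
  have := hnf' s
  have e1 : (1 - (1/2 : ℝ) ^ hh e) * gg e (x :: ν) =
    gg e (x :: ν) - (1/2 : ℝ) ^ hh e * gg e (x :: ν) := by ring
  linarith

/-- Some child for each program is returned and never full, if `ν` is never returned. -/
theorem exists_stuck (C : Ctx U S Us X) {e ν i} 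
    (hi : ν.length + (i + 1) = NN e) (hlive : live Us X e ν) (hnr : ¬ ret Us X e ν)
    (ih : ∀ x : Ent, live Us X e (x :: ν) → ret Us X e (x :: ν)) {ρ σ : Str} (hσ : σ ∈ U ρ) :
    ∃ j, ret Us X e (((ρ, σ.length), j) :: ν) ∧ ∀ s, ¬ full Us X s e ((ρ, σ.length), j) ν := by
  have hnr' : ∀ s, rcnt Us X s e ν (NN e - ν.length) < gg e ν := by
    intro s
    by_contra h
    exact hnr ⟨s, not_lt.1 h⟩
  obtain ⟨t0, ht0⟩ := (C.umem _ _).1 hσ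
  have hex : ∃ j, ∀ s, ¬ full Us X s e ((ρ, σ.length), j) ν := by
    by_contra hno
    push Not at hno
    choose s hs using hno
    obtain ⟨G, hG⟩ : ∃ G, G = gg e (((ρ, σ.length), 0) :: ν) := ⟨_, rfl⟩
    have hGj : ∀ j, gg e (((ρ, σ.length), j) :: ν) = G := by
      intro j; rw [hG, gg_cons, gg_cons]
    have hGpos : 0 < (1 - (1/2 : ℝ) ^ hh e) * G := by
      have := gg_pos e (((ρ, σ.length), 0) :: ν)
      rw [← hG] at this
      have := eta_lt e
      apply mul_pos <;> linarith
    obtain ⟨J, hJ⟩ := exists_nat_gt (gg e ν / ((1 - (1/2 : ℝ) ^ hh e) * G))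
    rw [div_lt_iff₀ hGpos] at hJ
    set T := (Finset.range J).sup s
    have h1 := rcnt_children (Us := Us) (X := X) (s := T) (e := e) (ν := ν) (i := NN e - ν.length)
      ((Finset.range J).image fun j => ((ρ, σ.length), j))
    rw [Finset.sum_image (by intro a _ b _ h; simpa using h)] at h1
    have h2 : ∑ j ∈ Finset.range J, (1 - (1/2 : ℝ) ^ hh e) * G ≤
        ∑ j ∈ Finset.range J, rcnt Us X T e (((ρ, σ.length), j) :: ν) (NN e - ν.length) := by
      refine Finset.sum_le_sum fun j hj => ?_
      have := full_mono (Finset.le_sup (f := s) hj) (hs j)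
      rw [full, hGj] at this
      exact this
    rw [Finset.sum_const, Finset.card_range, nsmul_eq_mul] at h2
    have := hnr' T
    linarith
  have hspec := Nat.find_spec hex
  have hmin : ∀ j' < Nat.find hex, ¬ ∀ s, ¬ full Us X s e ((ρ, σ.length), j') ν :=
    fun j' h => Nat.find_min hex h
  generalize Nat.find hex = j at hspec hmin
  refine ⟨j, ih _ ?_, hspec⟩
  have hfull : ∀ᶠ s in atTop, j = 0 ∨ full Us X s e (prd ((ρ, σ.length), j)) ν := by
    rcases Nat.eq_zero_or_pos j with h | h
    · exact Eventually.of_forall fun _ => Or.inl h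
    · have := hmin (j - 1) (by omega)
      push Not at this
      obtain ⟨s, hs⟩ := this
      filter_upwards [eventually_ge_atTop s] with s' hs'
      exact Or.inr (full_mono hs' hs)
  filter_upwards [hlive, hfull, eventually_ge_atTop t0,
    eventually_ge_atTop (gam e (((ρ, σ.length), j) :: ν))] with s h1 h2 h3 h4
  rintro ⟨y, μ⟩ hq
  simp only at hq
  rcases List.suffix_cons_iff.1 hq with h | h
  · simp only [List.cons.injEq] at h
    obtain ⟨rfl, rfl⟩ := h
    rw [okc_iff h4]
    refine ⟨?_, hnr' s, h2⟩
    simp [C.um t0 s _ _ h3 ht0]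
  · exact h1 (y, μ) h

theorem ktriv_of_bound (hU : OptimalPF U) {A : Set ℕ} {c : ℕ}
    (h : ∀ ρ σ : Str, σ ∈ U ρ → KC U (restrSet A σ.length) ≤ (ρ.length + c : ℕ)) :
    KTrivialSet U A := by
  refine ⟨c, fun n => ?_⟩
  cases hk : KC U (zeroStr n) with
  | top => simp
  | coe k =>
    obtain ⟨ρ, h1, h2⟩ := (KC_le_iff U (zeroStr n) k).1 (le_of_eq hk)
    have h3 := h ρ _ h1
    rw [show (zeroStr n).length = n by simp [zeroStr]] at h3
    refine le_trans h3 ?_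
    push_cast
    gcongr

theorem node_ret (C : Ctx U S Us X) (hU : OptimalPF U) (hUs : Primrec₂ Us)
    (hX : Primrec (fun q : Bool × ℕ × ℕ => X q.1 q.2.1 q.2.2))
    (hnt : ∀ b, ¬ KTrivialSet U (S b)) {e : ℕ} (hans : answered U S Us X e) :
    ∀ i (ν : List Ent), ν.length + i = NN e → live Us X e ν → ret Us X e ν := by
  intro i
  induction i with
  | zero => exact fun ν hν hl => leaf_ret (by omega) hl
  | succ i ih =>
    intro ν hν hl
    by_contra hnr
    obtain ⟨c, hc⟩ := kc_exists hU
      (trivReq_primrec hUs hX e ν i (e + 1 + (2 * hh e + gam e ν)) (Nat.bodd i))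
      (triv_weight C e ν i (Nat.bodd i))
    refine hnt (Nat.bodd i) (ktriv_of_bound hU (c := e + 1 + (2 * hh e + gam e ν) + c) ?_)
    intro ρ σ hσ
    obtain ⟨j, hj1, hj2⟩ := exists_stuck C hν hl hnr
      (fun x hx => ih (x :: ν) (by simp; omega) hx) hσ
    have h1 := stuck C hans hν hj1 hj2
    obtain ⟨t0, ht0⟩ := (C.umem _ _).1 hσ
    obtain ⟨s, a1, a2, a3, a4⟩ := (h1.and ((Xs_limit C (Nat.bodd i) σ.length).and
      ((eventually_ge_atTop t0).and
        (eventually_ge_atTop (gam e (((ρ, σ.length), j) :: ν)))))).exists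
    have h2 := hc (Nat.pair (Encodable.encode (((ρ, σ.length), j) : Ent)) s)
      (ρ.length + (e + 1 + (2 * hh e + gam e ν))) (restrSet (S (Nat.bodd i)) σ.length) (by
        rw [trivReq_iff]
        refine ⟨((ρ, σ.length), j), ?_, ?_, ?_, ?_, ?_⟩
        · rw [Nat.unpair_pair, Encodable.encodek]
        · simp only [Nat.unpair_pair]
          simp [C.um t0 s _ _ a3 ht0]
        · simp only [Nat.unpair_pair]; exact a4
        · simp only [Nat.unpair_pair]; exact a1
        · simp only [Nat.unpair_pair, a2])
    refine le_trans h2 (le_of_eq ?_)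
    push_cast
    ring

theorem contra (C : Ctx U S Us X) (hU : OptimalPF U) (hUs : Primrec₂ Us)
    (hX : Primrec (fun q : Bool × ℕ × ℕ => X q.1 q.2.1 q.2.2))
    (hnt : ∀ b, ¬ KTrivialSet U (S b)) {e : ℕ} (hans : answered U S Us X e) : False := by
  have hl : live Us X e [] := by
    refine Eventually.of_forall fun s q hq => ?_
    simp at hq
  obtain ⟨s, hs⟩ := node_ret C hU hUs hX hnt hans (NN e) [] (by simp) hl
  simp only [List.length_nil, Nat.sub_zero] at hs
  have h1 := vsum C e s ((LL Us X s).toFinset.filter fun p => p.1 = e ∧ [] <:+ p.2 ∧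
    NN e ≤ vv Us X s p) (by intro p hp; simp only [Finset.mem_filter] at hp; exact hp.2.1)
  have h2 : rcnt Us X s e [] (NN e) * NN e ≤ 2 * 2 ^ e := by
    refine le_trans ?_ h1
    unfold rcnt rW'
    rw [Finset.sum_mul]
    refine le_trans (le_of_eq (Finset.sum_congr (by ext p; simp only [Finset.mem_filter])
      fun _ _ => rfl)) (Finset.sum_le_sum (s := (LL Us X s).toFinset.filter fun p =>
        p.1 = e ∧ [] <:+ p.2 ∧ NN e ≤ vv Us X s p) fun p hp => ?_)
    simp only [Finset.mem_filter] at hp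
    have : (NN e : ℝ) ≤ vv Us X s p := by exact_mod_cast hp.2.2.2
    gcongr
  have h3 : gg e [] * NN e = 4 * 2 ^ e := by
    have : (1/2 : ℝ) ^ e * 2 ^ e = 1 := by rw [← mul_pow]; norm_num
    simp only [gg, gam, NN, List.map_nil, List.sum_nil, add_zero]
    push_cast
    rw [pow_add, pow_add, two_mul, pow_add]
    linear_combination (4 * 2 ^ e) * this
  have h4 : (0 : ℝ) < 2 ^ e := by positivity
  have h5 : gg e [] * NN e ≤ rcnt Us X s e [] (NN e) * NN e :=
    mul_le_mul_of_nonneg_right hs (by positivity)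
  linarith

end

theorem stmt12 (U : Str →. Str) (hU : OptimalPF U)
    (A D : Set ℕ) (hA : CESet A) (hD : CESet D)
    (hAnt : ¬ KTrivialSet U A) (hDnt : ¬ KTrivialSet U D) :
    ∀ c : ℕ, ∃ n : ℕ, KC U (zeroStr n) + c < KC U (restrSet A n) ∧
      KC U (zeroStr n) + c < KC U (restrSet D n) := by
  intro c
  by_contra hno
  push Not at hno
  obtain ⟨Us, hUs, um, umem⟩ := exists_Us hU.1.1
  obtain ⟨XA, hXA, xam, xamem⟩ := exists_X hA
  obtain ⟨XD, hXD, xdm, xdmem⟩ := exists_X hD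
  let S : Bool → Set ℕ := fun b => cond b A D
  let X : Bool → ℕ → ℕ → Bool := fun b s n => cond b (XA s n) (XD s n)
  have hX : Primrec (fun q : Bool × ℕ × ℕ => X q.1 q.2.1 q.2.2) :=
    Primrec.cond Primrec.fst
      (hXA.comp (Primrec.fst.comp Primrec.snd) (Primrec.snd.comp Primrec.snd))
      (hXD.comp (Primrec.fst.comp Primrec.snd) (Primrec.snd.comp Primrec.snd))
  have C : Ctx U S Us X := by
    refine ⟨um, umem, hU.1.2, ?_, ?_⟩
    · intro b s t n
      cases b
      · exact xdm s t n
      · exact xam s t n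
    · intro b n
      cases b
      · exact xdmem n
      · exact xamem n
  have hnt : ∀ b, ¬ KTrivialSet U (S b) := by
    intro b
    cases b
    · exact hDnt
    · exact hAnt
  obtain ⟨c1, hc1⟩ := kc_exists hU (mainReq_primrec hUs hX) (main_weight C)
  refine contra C hU hUs hX hnt (e := c1 + c) ?_
  intro p t hp hpe
  obtain ⟨t', -, -, h1⟩ := LL_origin hp
  have h2 : mainReq Us X (t' + 1) = Option.some (kk p, zeroStr (mm p)) := by
    simp [mainReq, h1]
  have h3 := hc1 _ _ _ h2
  have h4 : KC U (zeroStr (mm p)) + c ≤ ((kk p + p.1 : ℕ) : ℕ∞) := by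
    rw [hpe]
    push_cast
    rw [← add_assoc]
    gcongr
  by_cases hAm : KC U (zeroStr (mm p)) + c < KC U (restrSet A (mm p))
  · have h5 := le_trans (hno _ hAm) h4
    obtain ⟨ρ, a, b⟩ := (KC_le_iff _ _ _).1 h5
    exact ⟨false, ρ, b, a⟩
  · have h5 := le_trans (not_lt.1 hAm) h4
    obtain ⟨ρ, a, b⟩ := (KC_le_iff _ _ _).1 h5
    exact ⟨true, ρ, b, a⟩


end KPaper
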